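/- arXiv:1804.07989 — 3 statements merged into one kernel-verified Lean document; each statement's English description precedes it below -/
import Mathlib

section
/- For all r ≥ 1 and n₁,…,n_r ∈ ℤ_{≥0} with n₁ ≠ 1 and n_r ≠ 1, and for all τ ∈ ℍ: A(n₁,…,n_r; τ+1) = A(n₁,…,n_r; τ) and A(n₁,…,n_r; −1/τ) = B(n₁,…,n_r; τ). -/
open scoped Real Nat
open Finset MeasureTheory

/-- The coefficients `f_n(ξ,τ)` of the expansion of the Kronecker function:
`f₀ = 2πi`, `f₁(ξ,τ) = π cot(πξ) − 2πi Σ_{m,p≥1}(e^{2πimξ} − e^{−2πimξ}) q^{mp}` and, for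
`n ≥ 2`, `f_n(ξ,τ) = (2πi/(n−1)!)(Bₙ/n − Σ_{m,p≥1}(e^{2πimξ} + (−1)ⁿ e^{−2πimξ}) p^{n−1} q^{mp})`
(Bernoulli numbers with `B₁ = −1/2`). -/
noncomputable def fKr : ℕ → ℂ → ℂ → ℂ
  | 0, _, _ => 2 * ↑π * Complex.I
  | 1, ξ, τ =>
      ↑π * Complex.cot (↑π * ξ) -
        2 * ↑π * Complex.I *
          ∑' mp : ℕ × ℕ,
            (Complex.exp (2 * ↑π * Complex.I * ((mp.1 : ℂ) + 1) * ξ) -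
                Complex.exp (-(2 * ↑π * Complex.I * ((mp.1 : ℂ) + 1) * ξ))) *
              Complex.exp (2 * ↑π * Complex.I * τ) ^ ((mp.1 + 1) * (mp.2 + 1))
  | (n + 2), ξ, τ =>
      (2 * ↑π * Complex.I / ((n + 1)! : ℂ)) *
        ((bernoulli (n + 2) : ℂ) / ((n : ℂ) + 2) -
          ∑' mp : ℕ × ℕ,
            (Complex.exp (2 * ↑π * Complex.I * ((mp.1 : ℂ) + 1) * ξ) +
                (-1 : ℂ) ^ (n + 2) *
                  Complex.exp (-(2 * ↑π * Complex.I * ((mp.1 : ℂ) + 1) * ξ))) *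
              ((mp.2 : ℂ) + 1) ^ (n + 1) *
              Complex.exp (2 * ↑π * Complex.I * τ) ^ ((mp.1 + 1) * (mp.2 + 1)))

/-- `ω_n(ξ,τ) = Σ_{k=0}^{n} ((Im ξ/Im τ)^k / k!) · f_{n−k}(ξ,τ)`. -/
noncomputable def omKr (n : ℕ) (ξ τ : ℂ) : ℂ :=
  ∑ k ∈ Finset.range (n + 1),
    (((ξ.im / τ.im) ^ k / (k ! : ℝ) : ℝ) : ℂ) * fKr (n - k) ξ τ

/-- The open simplex `{1 > t₁ > ⋯ > t_r > 0}` in `(Fin r → ℝ)`. -/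
def openSimplex (r : ℕ) : Set (Fin r → ℝ) :=
  {t | (∀ i, 0 < t i ∧ t i < 1) ∧ ∀ i j : Fin r, i < j → t j < t i}

/-- The A-elliptic multiple zeta value
`A(n₁,…,n_r;τ) = ∫_{1>t₁>⋯>t_r>0} f_{n₁}(t₁,τ)⋯f_{n_r}(t_r,τ) dt`. -/
noncomputable def Aell {r : ℕ} (n : Fin r → ℕ) (τ : ℂ) : ℂ :=
  ∫ t in openSimplex r, ∏ i, fKr (n i) ((t i : ℝ) : ℂ) τ

/-- The B-elliptic multiple zeta value
`B(n₁,…,n_r;τ) = τ^{n₁+⋯+n_r} ∫_{1>t₁>⋯>t_r>0} ω_{n₁}(τt₁,τ)⋯ω_{n_r}(τt_r,τ) dt`. -/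
noncomputable def Bell {r : ℕ} (n : Fin r → ℕ) (τ : ℂ) : ℂ :=
  τ ^ (∑ i, n i) * ∫ t in openSimplex r, ∏ i, omKr (n i) (τ * ((t i : ℝ) : ℂ)) τ

open Filter Topology

theorem HasSum.of_eq {u v : ℕ → ℂ} {a : ℂ} (hv : HasSum v a) (h : ∀ n, u n = v n) :
    HasSum u a := by
  rwa [funext h]

/-- `f` is given near `0`, except possibly at `0` itself, by the convergent power series `p`. -/
def HasExpansion (f : ℂ → ℂ) (p : PowerSeries ℂ) : Prop :=
  ∀ᶠ x in 𝓝[≠] (0 : ℂ), HasSum (fun n => x ^ n * p.coeff n) (f x)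

namespace HasExpansion

variable {f g : ℂ → ℂ} {p s : PowerSeries ℂ}

theorem congr (hf : HasExpansion f p) (h : ∀ᶠ x in 𝓝[≠] (0 : ℂ), f x = g x) :
    HasExpansion g p := by
  filter_upwards [hf, h] with x hx he
  rwa [← he]

theorem add (hf : HasExpansion f p) (hg : HasExpansion g s) :
    HasExpansion (fun x => f x + g x) (p + s) := by
  filter_upwards [hf, hg] with x hx hy
  simpa [mul_add] using hx.add hy

theorem sub (hf : HasExpansion f p) (hg : HasExpansion g s) :
    HasExpansion (fun x => f x - g x) (p - s) := by
  filter_upwards [hf, hg] with x hx hy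
  simpa [mul_sub] using hx.sub hy

theorem mul (hf : HasExpansion f p) (hg : HasExpansion g s) :
    HasExpansion (fun x => f x * g x) (p * s) := by
  filter_upwards [hf, hg] with x hx hy
  have hx' := hx.summable.norm
  have hy' := hy.summable.norm
  have hsum := (summable_norm_sum_mul_antidiagonal_of_summable_norm hx' hy').of_norm.hasSum
  rw [← tsum_mul_tsum_eq_tsum_sum_antidiagonal_of_summable_norm hx' hy', hx.tsum_eq,
    hy.tsum_eq] at hsum
  refine hsum.of_eq fun n => ?_
  rw [PowerSeries.coeff_mul, Finset.mul_sum]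
  refine Finset.sum_congr rfl fun kl hkl => ?_
  rw [← Finset.HasAntidiagonal.mem_antidiagonal.mp hkl]
  ring

theorem comp_mul_left (hf : HasExpansion f p) {c : ℂ} (hc : c ≠ 0) :
    HasExpansion (fun x => f (c * x)) (PowerSeries.rescale c p) := by
  have ht : Tendsto (fun x : ℂ => c * x) (𝓝[≠] 0) (𝓝[≠] 0) := by
    refine tendsto_nhdsWithin_of_tendsto_nhds_of_eventually_within _ ?_ ?_
    · have : Tendsto (fun x : ℂ => c * x) (𝓝 0) (𝓝 (c * 0)) := by
        apply Continuous.tendsto; fun_prop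
      rw [mul_zero] at this
      exact this.mono_left nhdsWithin_le_nhds
    · filter_upwards [self_mem_nhdsWithin] with x hx
      exact mul_ne_zero hc hx
  filter_upwards [ht.eventually hf] with x hx
  convert hx using 2 with n
  rw [PowerSeries.coeff_rescale]
  ring

theorem const (c : ℂ) : HasExpansion (fun _ => c) (PowerSeries.C c) := by
  refine Eventually.of_forall fun x => ?_
  convert hasSum_ite_eq (0 : ℕ) c using 2 with n
  rw [PowerSeries.coeff_C]
  split_ifs with h <;> simp [h]

theorem id : HasExpansion (fun x => x) PowerSeries.X := by
  refine Eventually.of_forall fun x => ?_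
  convert hasSum_ite_eq (1 : ℕ) x using 2 with n
  rw [PowerSeries.coeff_X]
  split_ifs with h <;> simp [h]

theorem exp : HasExpansion Complex.exp (PowerSeries.exp ℂ) := by
  refine Eventually.of_forall fun x => ?_
  have := NormedSpace.expSeries_div_hasSum_exp x
  rw [← Complex.exp_eq_exp_ℂ] at this
  refine this.of_eq fun n => ?_
  simp [PowerSeries.coeff_exp, div_eq_mul_inv]

theorem of_analyticAt (hf : AnalyticAt ℂ f 0) : ∃ p, HasExpansion f p := by
  obtain ⟨a, ha⟩ := hf
  refine ⟨PowerSeries.mk fun n => a.coeff n, ?_⟩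
  rw [hasFPowerSeriesAt_iff] at ha
  refine (ha.filter_mono nhdsWithin_le_nhds).mono fun x hx => ?_
  simpa using hx

/-- The formal multilinear series with the coefficients of a power series. -/
noncomputable def multilinearSeries (p : PowerSeries ℂ) : FormalMultilinearSeries ℂ ℂ ℂ :=
  fun n => ContinuousMultilinearMap.mkPiRing ℂ (Fin n) (p.coeff n)

theorem coeff_multilinearSeries (p : PowerSeries ℂ) (n : ℕ) :
    (multilinearSeries p).coeff n = p.coeff n := by
  simp [FormalMultilinearSeries.coeff, multilinearSeries]

theorem hasFPowerSeriesAt (hf : HasExpansion f p) :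
    HasFPowerSeriesAt (fun x => ∑' n, x ^ n * p.coeff n) (multilinearSeries p) 0 := by
  rw [hasFPowerSeriesAt_iff]
  simp only [coeff_multilinearSeries, zero_add, smul_eq_mul]
  have h := eventually_nhdsWithin_iff.mp hf
  filter_upwards [h] with x hx
  by_cases h0 : x = 0
  · subst h0
    refine Summable.hasSum (summable_of_ne_finset_zero (s := {0}) fun n hn => ?_)
    simp at hn
    simp [hn]
  · exact (hx h0).summable.hasSum

theorem unique (hf : HasExpansion f p) (hg : HasExpansion f s) : p = s := by
  have h1 := hf.hasFPowerSeriesAt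
  have h2 := hg.hasFPowerSeriesAt
  have he : (fun x => ∑' n, x ^ n * p.coeff n) =ᶠ[𝓝[≠] 0]
      (fun x => ∑' n, x ^ n * s.coeff n) := by
    filter_upwards [hf, hg] with x hx hy
    rw [hx.tsum_eq, hy.tsum_eq]
  have he' := (h1.analyticAt.frequently_eq_iff_eventually_eq h2.analyticAt).mp he.frequently
  have := h1.eq_formalMultilinearSeries_of_eventually h2 he'
  ext n
  rw [← coeff_multilinearSeries p, this, coeff_multilinearSeries]

end HasExpansion

/-- The entire function `(exp x - 1) / x`. -/
noncomputable def expQuot : ℂ → ℂ := dslope Complex.exp 0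

theorem differentiable_expQuot : Differentiable ℂ expQuot := by
  rw [← differentiableOn_univ, expQuot, Complex.differentiableOn_dslope univ_mem]
  exact Complex.differentiable_exp.differentiableOn

theorem expQuot_zero : expQuot 0 = 1 := by simp [expQuot, dslope_same]

theorem expQuot_of_ne {x : ℂ} (hx : x ≠ 0) : expQuot x = (Complex.exp x - 1) / x := by
  simp [expQuot, dslope_of_ne _ hx, slope_def_field]

theorem hasExpansion_bernoulli :
    HasExpansion (fun x => x / (Complex.exp x - 1)) (bernoulliPowerSeries ℂ) := by
  have han : AnalyticAt ℂ (fun x => (expQuot x)⁻¹) 0 :=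
    (differentiable_expQuot.analyticAt 0).inv (by simp [expQuot_zero])
  obtain ⟨p, hp⟩ := HasExpansion.of_analyticAt han
  have hne : ∀ᶠ x in 𝓝[≠] (0 : ℂ), expQuot x ≠ 0 := by
    refine Filter.Eventually.filter_mono nhdsWithin_le_nhds ?_
    exact differentiable_expQuot.continuous.continuousAt.eventually_ne (by simp [expQuot_zero])
  have hmul := hp.mul (HasExpansion.exp.sub (HasExpansion.const 1))
  have hX : p * (PowerSeries.exp ℂ - PowerSeries.C 1) = PowerSeries.X := by
    refine hmul.unique (HasExpansion.id.congr ?_)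
    filter_upwards [hne, self_mem_nhdsWithin] with x hx hx0
    rw [expQuot_of_ne hx0] at hx ⊢
    have : Complex.exp x - 1 ≠ 0 := fun h => hx (by simp [h])
    have hx0' : x ≠ 0 := hx0
    field_simp
  have hpe : p = bernoulliPowerSeries ℂ := by
    have h2 := bernoulliPowerSeries_mul_exp_sub_one ℂ
    rw [map_one] at hX
    rw [← h2] at hX
    refine mul_right_cancel₀ ?_ hX
    intro h
    have := congrArg (PowerSeries.coeff 1) h
    simp [PowerSeries.coeff_exp] at this
  rw [← hpe]
  refine hp.congr ?_
  filter_upwards [self_mem_nhdsWithin] with x hx0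
  rw [expQuot_of_ne hx0, inv_div]

/-- The Lambert-type series `∑_{m ≥ 1} z^m · w q^m / (1 - w q^m)`. -/
noncomputable def lambert (z w q : ℂ) : ℂ :=
  ∑' m : ℕ, z ^ (m + 1) * (w * q ^ (m + 1) / (1 - w * q ^ (m + 1)))

theorem summable_double_geometric {z w q : ℝ} (hz : 0 ≤ z) (hw : 0 ≤ w) (hq : 0 ≤ q)
    (hq1 : q < 1) (hzq : z * q < 1) (hwq : w * q < 1) :
    Summable fun mp : ℕ × ℕ =>
      z ^ (mp.1 + 1) * w ^ (mp.2 + 1) * q ^ ((mp.1 + 1) * (mp.2 + 1)) := by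
  have h1 := summable_geometric_of_lt_one (mul_nonneg hz hq) hzq
  have h2 := summable_geometric_of_lt_one (mul_nonneg hw hq) hwq
  have h := (h1.mul_of_nonneg h2 (fun n => by positivity) (fun n => by positivity)).mul_left
    (z * w * q)
  refine Summable.of_nonneg_of_le (fun mp => by positivity) (fun mp => ?_) h
  obtain ⟨m, p⟩ := mp
  have : z ^ (m + 1) * w ^ (p + 1) * q ^ ((m + 1) * (p + 1)) =
      z * w * q * ((z * q) ^ m * (w * q) ^ p) * q ^ (m * p) := by ring
  rw [this]
  exact mul_le_of_le_one_right (by positivity) (pow_le_one₀ hq hq1.le)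

theorem summable_double_geometric_complex {z w q : ℂ}
    (hq1 : ‖q‖ < 1) (hzq : ‖z * q‖ < 1) (hwq : ‖w * q‖ < 1) :
    Summable fun mp : ℕ × ℕ =>
      z ^ (mp.1 + 1) * w ^ (mp.2 + 1) * q ^ ((mp.1 + 1) * (mp.2 + 1)) := by
  rw [norm_mul] at hzq hwq
  refine Summable.of_norm ?_
  simpa using summable_double_geometric (norm_nonneg z) (norm_nonneg w) (norm_nonneg q) hq1 hzq hwq

theorem norm_mul_pow_succ_lt_one {w q : ℂ} (hq1 : ‖q‖ < 1) (hwq : ‖w * q‖ < 1) (m : ℕ) :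
    ‖w * q ^ (m + 1)‖ < 1 := by
  have : w * q ^ (m + 1) = (w * q) * q ^ m := by ring
  rw [this, norm_mul, norm_pow]
  exact lt_of_le_of_lt
    (mul_le_of_le_one_right (norm_nonneg _) (pow_le_one₀ (norm_nonneg _) hq1.le)) hwq

theorem lambert_eq_double {z w q : ℂ}
    (hq1 : ‖q‖ < 1) (hzq : ‖z * q‖ < 1) (hwq : ‖w * q‖ < 1) :
    lambert z w q = ∑' mp : ℕ × ℕ,
      z ^ (mp.1 + 1) * w ^ (mp.2 + 1) * q ^ ((mp.1 + 1) * (mp.2 + 1)) := by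
  rw [(summable_double_geometric_complex hq1 hzq hwq).tsum_prod]
  refine tsum_congr fun m => ?_
  have hg := (hasSum_geometric_of_norm_lt_one (norm_mul_pow_succ_lt_one hq1 hwq m)).mul_left
    (z ^ (m + 1) * (w * q ^ (m + 1)))
  rw [show z ^ (m + 1) * (w * q ^ (m + 1) / (1 - w * q ^ (m + 1))) =
    z ^ (m + 1) * (w * q ^ (m + 1)) * (1 - w * q ^ (m + 1))⁻¹ by ring, ← hg.tsum_eq]
  refine tsum_congr fun p => ?_
  ring


/-- The coefficients of the expansion of `lambert z (exp x) q` in `x`, up to `1 / n!`. -/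
noncomputable def lambertCoeff (z q : ℂ) (n : ℕ) : ℂ :=
  ∑' mp : ℕ × ℕ, z ^ (mp.1 + 1) * ((mp.2 : ℂ) + 1) ^ n * q ^ ((mp.1 + 1) * (mp.2 + 1))

theorem summable_lambert_exp {z q x : ℂ} (hq1 : ‖q‖ < 1) (hzq : ‖z * q‖ < 1)
    (hx : Real.exp ‖x‖ * ‖q‖ < 1) :
    Summable fun mpn : (ℕ × ℕ) × ℕ =>
      z ^ (mpn.1.1 + 1) * q ^ ((mpn.1.1 + 1) * (mpn.1.2 + 1)) *
        ((((mpn.1.2 : ℂ) + 1) * x) ^ mpn.2 / (mpn.2 ! : ℂ)) := by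
  refine Summable.of_norm ?_
  have hexp : ∀ y : ℝ, HasSum (fun n : ℕ => y ^ n / (n ! : ℝ)) (Real.exp y) := by
    intro y
    have := NormedSpace.expSeries_div_hasSum_exp y
    rwa [← Real.exp_eq_exp_ℝ] at this
  have hnorm : ∀ (m p n : ℕ), ‖z ^ (m + 1) * q ^ ((m + 1) * (p + 1)) *
        ((((p : ℂ) + 1) * x) ^ n / (n ! : ℂ))‖ =
      ‖z‖ ^ (m + 1) * ‖q‖ ^ ((m + 1) * (p + 1)) * ((((p : ℝ) + 1) * ‖x‖) ^ n / (n ! : ℝ)) := by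
    intro m p n
    have : ‖(p : ℂ) + 1‖ = (p : ℝ) + 1 := by
      rw [← Nat.cast_succ, Complex.norm_natCast, Nat.cast_succ]
    simp [this]
  rw [summable_prod_of_nonneg fun _ => norm_nonneg _]
  refine ⟨fun mp => ?_, ?_⟩
  · simp only [hnorm]
    exact (hexp _).summable.mul_left _
  · simp only [hnorm]
    rw [norm_mul] at hzq
    refine (summable_double_geometric (norm_nonneg z) (Real.exp_pos ‖x‖).le (norm_nonneg q)
      hq1 hzq hx).congr fun mp => ?_
    rw [((hexp _).mul_left _).tsum_eq, ← Real.exp_nat_mul]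
    push_cast
    ring

theorem eventually_exp_norm_mul_lt_one {q : ℂ} (hq1 : ‖q‖ < 1) :
    ∀ᶠ x in 𝓝 (0 : ℂ), Real.exp ‖x‖ * ‖q‖ < 1 := by
  have hc : ContinuousAt (fun x : ℂ => Real.exp ‖x‖ * ‖q‖) 0 := by fun_prop
  exact hc.eventually_lt_const (by simpa using hq1)

theorem hasExpansion_lambert {z q : ℂ} (hq1 : ‖q‖ < 1) (hzq : ‖z * q‖ < 1) :
    HasExpansion (fun x => lambert z (Complex.exp x) q)
      (PowerSeries.mk fun n => lambertCoeff z q n / (n ! : ℂ)) := by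
  refine Filter.Eventually.filter_mono nhdsWithin_le_nhds ?_
  filter_upwards [eventually_exp_norm_mul_lt_one hq1] with x hx
  have hs := summable_lambert_exp hq1 hzq hx
  have hwq : ‖Complex.exp x * q‖ < 1 := by
    rw [norm_mul, Complex.norm_exp]
    refine lt_of_le_of_lt (mul_le_mul_of_nonneg_right ?_ (norm_nonneg _)) hx
    exact Real.exp_le_exp.mpr (Complex.re_le_norm x)
  have hexp : ∀ y : ℂ, HasSum (fun n : ℕ => y ^ n / (n ! : ℂ)) (Complex.exp y) := by
    intro y
    have := NormedSpace.expSeries_div_hasSum_exp y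
    rwa [← Complex.exp_eq_exp_ℂ] at this
  have hval : lambert z (Complex.exp x) q = ∑' mpn : (ℕ × ℕ) × ℕ,
      z ^ (mpn.1.1 + 1) * q ^ ((mpn.1.1 + 1) * (mpn.1.2 + 1)) *
        ((((mpn.1.2 : ℂ) + 1) * x) ^ mpn.2 / (mpn.2 ! : ℂ)) := by
    rw [lambert_eq_double hq1 hzq hwq, hs.tsum_prod]
    refine tsum_congr fun mp => ?_
    rw [((hexp ((mp.2 + 1) * x)).mul_left (z ^ (mp.1 + 1) * q ^ ((mp.1 + 1) * (mp.2 + 1)))).tsum_eq,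
      ← Complex.exp_nat_mul]
    push_cast
    ring
  have hs' := hs.prod_symm
  have := hs'.hasSum.prod_fiberwise fun n => (hs'.prod_factor n).hasSum
  have hswap := (Equiv.prodComm ℕ (ℕ × ℕ)).tsum_eq (fun mpn : (ℕ × ℕ) × ℕ =>
      z ^ (mpn.1.1 + 1) * q ^ ((mpn.1.1 + 1) * (mpn.1.2 + 1)) *
        ((((mpn.1.2 : ℂ) + 1) * x) ^ mpn.2 / (mpn.2 ! : ℂ)))
  rw [hval, ← hswap]
  refine this.of_eq fun n => ?_
  rw [PowerSeries.coeff_mk, lambertCoeff, div_eq_mul_inv, ← mul_assoc, mul_comm, ← mul_assoc,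
    ← tsum_mul_left]
  refine tsum_congr fun mp => ?_
  simp only [Prod.swap_prod_mk, mul_pow]
  ring

theorem summable_lambert {z w q : ℂ} (hq1 : ‖q‖ < 1) (hzq : ‖z * q‖ < 1) (hwq : ‖w * q‖ < 1) :
    Summable fun m : ℕ => z ^ (m + 1) * (w * q ^ (m + 1) / (1 - w * q ^ (m + 1))) := by
  refine (summable_double_geometric_complex hq1 hzq hwq).prod.congr fun m => ?_
  have hg := (hasSum_geometric_of_norm_lt_one (norm_mul_pow_succ_lt_one hq1 hwq m)).mul_left
    (z ^ (m + 1) * (w * q ^ (m + 1)))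
  rw [show z ^ (m + 1) * (w * q ^ (m + 1) / (1 - w * q ^ (m + 1))) =
    z ^ (m + 1) * (w * q ^ (m + 1)) * (1 - w * q ^ (m + 1))⁻¹ by ring, ← hg.tsum_eq]
  refine tsum_congr fun p => ?_
  ring

theorem lambert_mul_q {z w q : ℂ} (hq1 : ‖q‖ < 1) (hzq : ‖z * q‖ < 1) (hwq : ‖w * q‖ < 1) :
    lambert z w q = z * (w * q / (1 - w * q)) + z * lambert z (w * q) q := by
  rw [lambert, (summable_lambert hq1 hzq hwq).tsum_eq_zero_add, lambert, ← tsum_mul_left]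
  congr 1
  · simp
  · refine tsum_congr fun m => ?_
    rw [show w * q * q ^ (m + 1) = w * q ^ (m + 1 + 1) by ring]
    ring

/-- The Kronecker function in multiplicative variables, divided by `2πi`. -/
noncomputable def kronecker (z w q : ℂ) : ℂ :=
  z / (z - 1) + 1 / (w - 1) - lambert z w q + lambert z⁻¹ w⁻¹ q

theorem kronecker_mul_q {z w q : ℂ} (hz0 : z ≠ 0) (hz1 : z ≠ 1) (hq0 : q ≠ 0) (hq1 : ‖q‖ < 1)
    (hzq : ‖z * q‖ < 1) (hzq' : ‖z⁻¹ * q‖ < 1) (hw : 1 < ‖w‖) (hwq : ‖w * q‖ < 1) :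
    kronecker z (w * q) q = z⁻¹ * kronecker z w q := by
  have hw0 : w ≠ 0 := norm_pos_iff.mp (by linarith)
  have hinv : (w * q)⁻¹ * q = w⁻¹ := by field_simp
  have hw' : ‖(w * q)⁻¹ * q‖ < 1 := by
    rw [hinv, norm_inv]
    exact inv_lt_one_of_one_lt₀ hw
  have h1 := lambert_mul_q hq1 hzq hwq
  have h2 := lambert_mul_q hq1 hzq' hw'
  rw [hinv] at h2
  have hw1 : w - 1 ≠ 0 := by
    intro h
    rw [sub_eq_zero.mp h, norm_one] at hw
    exact lt_irrefl _ hw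
  have hwq1 : 1 - w * q ≠ 0 := by
    intro h
    rw [← sub_eq_zero.mp h, norm_one] at hwq
    exact lt_irrefl _ hwq
  have hwq1' : w * q - 1 ≠ 0 := fun h => hwq1 (by linear_combination -h)
  have hz1' : z - 1 ≠ 0 := sub_ne_zero.mpr hz1
  have hwi : 1 - w⁻¹ = (w - 1) / w := by field_simp
  rw [kronecker, kronecker, h2, h1, hwi, show w * q - 1 = -(1 - w * q) by ring]
  field_simp
  ring

theorem differentiableAt_lambert {z w q : ℂ} (hq0 : q ≠ 0) (hq1 : ‖q‖ < 1) (hzq : ‖z * q‖ < 1)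
    (hwq : ‖w * q‖ < 1) : DifferentiableAt ℂ (fun w => lambert z w q) w := by
  have hqp : 0 < ‖q‖ := norm_pos_iff.mpr hq0
  rw [norm_mul] at hwq hzq
  obtain ⟨R, hwR, hR⟩ := exists_between ((lt_div_iff₀ hqp).mpr hwq)
  rw [lt_div_iff₀ hqp] at hR
  have hR0 : 0 ≤ R := (norm_nonneg w).trans hwR.le
  have hb : ∀ v ∈ Metric.ball (0 : ℂ) R, ∀ m : ℕ, 1 - R * ‖q‖ ≤ ‖1 - v * q ^ (m + 1)‖ := by
    intro v hv m
    rw [mem_ball_zero_iff] at hv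
    have h1 : ‖v * q ^ (m + 1)‖ ≤ R * ‖q‖ := by
      rw [norm_mul, norm_pow, pow_succ']
      refine mul_le_mul hv.le ?_ (by positivity) hR0
      exact mul_le_of_le_one_right hqp.le (pow_le_one₀ hqp.le hq1.le)
    have h2 := norm_sub_norm_le (1 : ℂ) (v * q ^ (m + 1))
    rw [norm_one] at h2
    linarith
  have hpos : 0 < 1 - R * ‖q‖ := by linarith
  have hsum : Summable fun m : ℕ => (‖z‖ * ‖q‖) ^ m * (‖z‖ * ‖q‖ * (R / (1 - R * ‖q‖))) :=
    (summable_geometric_of_lt_one (by positivity) hzq).mul_right _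
  have hd : DifferentiableOn ℂ (fun w => lambert z w q) (Metric.ball 0 R) := by
    refine Complex.differentiableOn_tsum_of_summable_norm hsum (fun m => ?_) Metric.isOpen_ball
      (fun m v hv => ?_)
    · intro v hv
      have hne : 1 - v * q ^ (m + 1) ≠ 0 := norm_pos_iff.mp (hpos.trans_le (hb v hv m))
      refine DifferentiableAt.differentiableWithinAt ?_
      fun_prop (disch := assumption)
    · have hbv := hb v hv m
      rw [mem_ball_zero_iff] at hv
      rw [norm_mul, norm_div, norm_mul, norm_pow, norm_pow]
      calc ‖z‖ ^ (m + 1) * (‖v‖ * ‖q‖ ^ (m + 1) / ‖1 - v * q ^ (m + 1)‖)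
          ≤ ‖z‖ ^ (m + 1) * (R * ‖q‖ ^ (m + 1) / (1 - R * ‖q‖)) := by gcongr
        _ = _ := by ring
  exact hd.differentiableAt (Metric.isOpen_ball.mem_nhds (mem_ball_zero_iff.mpr hwR))

theorem eq_zero_of_quasiperiodic {g : ℂ → ℂ} {a b : ℂ → ℝ} {ω₁ ω₂ c₁ c₂ : ℂ}
    (ha : Continuous a) (hb : Continuous b)
    (hab : ∀ x, x = a x * ω₁ + b x * ω₂)
    (ha' : ∀ s t : ℝ, a (s * ω₁ + t * ω₂) = s) (hb' : ∀ s t : ℝ, b (s * ω₁ + t * ω₂) = t)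
    (hg : DifferentiableOn ℂ g {x | |a x| < 1 ∧ |b x| < 1})
    (hc₁ : ‖c₁‖ = 1) (hc₁' : c₁ ≠ 1) (hc₂ : ‖c₂‖ = 1)
    (h₁ : ∀ x, -1 < a x → a x < 0 → |b x| < 1 → g (x + ω₁) = c₁ * g x)
    (h₂ : ∀ x, |a x| < 1 → -1 < b x → b x < 0 → g (x + ω₂) = c₂ * g x) :
    ∀ x, |a x| < 1 → |b x| < 1 → g x = 0 := by
  set P : Set ℂ := {x | |a x| < 1 ∧ |b x| < 1} with hP
  have hPo : IsOpen P :=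
    (isOpen_lt ha.abs continuous_const).inter (isOpen_lt hb.abs continuous_const)
  let L : ℝ × ℝ → ℂ := fun st => st.1 * ω₁ + st.2 * ω₂
  have hL : Continuous L := by fun_prop
  have hPc : IsPreconnected P := by
    have : P = L '' (Set.Ioo (-1) 1 ×ˢ Set.Ioo (-1) 1) := by
      ext x
      constructor
      · rintro ⟨h, h'⟩
        exact ⟨(a x, b x), ⟨abs_lt.mp h, abs_lt.mp h'⟩, (hab x).symm⟩
      · rintro ⟨⟨s, t⟩, ⟨h, h'⟩, rfl⟩
        exact ⟨by simpa only [L, ha'] using abs_lt.mpr h, by simpa only [L, hb'] using abs_lt.mpr h'⟩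
    rw [this]
    exact (isPreconnected_Ioo.prod isPreconnected_Ioo).image L hL.continuousOn
  set K : Set ℂ := L '' (Set.Icc (-(1 / 2)) (1 / 2) ×ˢ Set.Icc (-(1 / 2)) (1 / 2)) with hK
  have hKc : IsCompact K := (isCompact_Icc.prod isCompact_Icc).image hL
  have hKP : K ⊆ P := by
    rintro _ ⟨⟨s, t⟩, ⟨⟨h1, h2⟩, ⟨h3, h4⟩⟩, rfl⟩
    simp only at h1 h2 h3 h4
    simp only [hP, Set.mem_ofPred_eq, L, ha', hb', abs_lt]
    refine ⟨⟨?_, ?_⟩, ?_, ?_⟩ <;> linarith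
  have hmemK : ∀ x, |a x| ≤ 1 / 2 → |b x| ≤ 1 / 2 → x ∈ K := fun x h h' =>
    ⟨(a x, b x), ⟨abs_le.mp h, abs_le.mp h'⟩, (hab x).symm⟩
  have hadd : ∀ (x : ℂ) (s t : ℝ), a (x + (s * ω₁ + t * ω₂)) = a x + s ∧
      b (x + (s * ω₁ + t * ω₂)) = b x + t := by
    intro x s t
    have : x + (s * ω₁ + t * ω₂) = ((a x + s : ℝ) : ℂ) * ω₁ + ((b x + t : ℝ) : ℂ) * ω₂ := by
      push_cast
      linear_combination hab x
    rw [this, ha', hb']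
    exact ⟨rfl, rfl⟩
  have hadd₁ : ∀ x, a (x + ω₁) = a x + 1 ∧ b (x + ω₁) = b x := by
    intro x; simpa using hadd x 1 0
  have hsub₁ : ∀ x, a (x - ω₁) = a x - 1 ∧ b (x - ω₁) = b x := by
    intro x; simpa [sub_eq_add_neg] using hadd x (-1) 0
  have hadd₂ : ∀ x, a (x + ω₂) = a x ∧ b (x + ω₂) = b x + 1 := by
    intro x; simpa using hadd x 0 1
  have hsub₂ : ∀ x, a (x - ω₂) = a x ∧ b (x - ω₂) = b x - 1 := by
    intro x; simpa [sub_eq_add_neg] using hadd x 0 (-1)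
  have step₁ : ∀ x ∈ P, ∃ y, |a y| ≤ 1 / 2 ∧ |b y| < 1 ∧ ‖g y‖ = ‖g x‖ := by
    rintro x ⟨hxa, hxb⟩
    rw [abs_lt] at hxa
    rcases le_or_gt |a x| (1 / 2) with h | h
    · exact ⟨x, h, hxb, rfl⟩
    rcases lt_abs.mp h with h | h
    · refine ⟨x - ω₁, ?_, ?_, ?_⟩
      · rw [(hsub₁ x).1, abs_le]; constructor <;> linarith
      · rwa [(hsub₁ x).2]
      · have := h₁ (x - ω₁) (by rw [(hsub₁ x).1]; linarith) (by rw [(hsub₁ x).1]; linarith)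
          (by rwa [(hsub₁ x).2])
        rw [sub_add_cancel] at this
        rw [this, norm_mul, hc₁, one_mul]
    · refine ⟨x + ω₁, ?_, ?_, ?_⟩
      · rw [(hadd₁ x).1, abs_le]; constructor <;> linarith
      · rwa [(hadd₁ x).2]
      · rw [h₁ x (by linarith) (by linarith) hxb, norm_mul, hc₁, one_mul]
  have step₂ : ∀ x, |a x| ≤ 1 / 2 → |b x| < 1 → ∃ y ∈ K, ‖g y‖ = ‖g x‖ := by
    rintro x hxa hxb
    rw [abs_lt] at hxb
    rcases le_or_gt |b x| (1 / 2) with h | h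
    · exact ⟨x, hmemK x hxa h, rfl⟩
    rcases lt_abs.mp h with h | h
    · refine ⟨x - ω₂, hmemK _ ?_ ?_, ?_⟩
      · rwa [(hsub₂ x).1]
      · rw [(hsub₂ x).2, abs_le]; constructor <;> linarith
      · have := h₂ (x - ω₂) (by rw [(hsub₂ x).1]; linarith) (by rw [(hsub₂ x).2]; linarith)
          (by rw [(hsub₂ x).2]; linarith)
        rw [sub_add_cancel] at this
        rw [this, norm_mul, hc₂, one_mul]
    · refine ⟨x + ω₂, hmemK _ ?_ ?_, ?_⟩
      · rwa [(hadd₂ x).1]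
      · rw [(hadd₂ x).2, abs_le]; constructor <;> linarith
      · rw [h₂ x (by linarith) (by linarith) (by linarith), norm_mul, hc₂, one_mul]
  have hKne : K.Nonempty := ⟨L (0, 0), (0, 0), by norm_num, rfl⟩
  obtain ⟨x₀, hx₀, hmax⟩ := hKc.exists_isMaxOn hKne (hg.continuousOn.mono hKP).norm
  have hmaxP : IsMaxOn (norm ∘ g) P x₀ := by
    intro x hx
    obtain ⟨y, hya, hyb, hy⟩ := step₁ x hx
    obtain ⟨y', hy'K, hy'⟩ := step₂ y hya hyb
    have := hmax hy'K
    simp only [Set.mem_ofPred_eq, Function.comp_apply] at this ⊢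
    rwa [← hy, ← hy']
  have hconst := Complex.eqOn_of_isPreconnected_of_isMaxOn_norm hPc hPo hg (hKP hx₀) hmaxP
  have hy : a (((-(1 / 2) : ℝ) : ℂ) * ω₁ + ((0 : ℝ) : ℂ) * ω₂) = -(1 / 2) := ha' _ _
  have hy' : b (((-(1 / 2) : ℝ) : ℂ) * ω₁ + ((0 : ℝ) : ℂ) * ω₂) = 0 := hb' _ _
  set y : ℂ := ((-(1 / 2) : ℝ) : ℂ) * ω₁ + ((0 : ℝ) : ℂ) * ω₂
  have hyP : y ∈ P := by
    constructor
    · rw [hy, abs_lt]; constructor <;> norm_num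
    · rw [hy']; norm_num
  have hyP' : y + ω₁ ∈ P := by
    constructor
    · rw [(hadd₁ y).1, hy, abs_lt]; constructor <;> norm_num
    · rw [(hadd₁ y).2, hy']; norm_num
  have hq := h₁ y (by rw [hy]; norm_num) (by rw [hy]; norm_num) (by rw [hy']; norm_num)
  rw [hconst hyP, hconst hyP'] at hq
  simp only [Function.const_apply] at hq
  have h0 : g x₀ = 0 := by
    have : (c₁ - 1) * g x₀ = 0 := by linear_combination -hq
    exact (mul_eq_zero.mp this).resolve_left (sub_ne_zero.mpr hc₁')
  intro x hxa hxb
  have := hconst (show x ∈ P from ⟨hxa, hxb⟩)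
  rw [this]
  exact h0

theorem expQuot_ne_zero {x : ℂ} (h : ∀ n : ℤ, x = n * (2 * π * Complex.I) → n = 0) :
    expQuot x ≠ 0 := by
  by_cases hx : x = 0
  · simp [hx, expQuot_zero]
  · rw [expQuot_of_ne hx]
    refine div_ne_zero (fun h0 => ?_) hx
    obtain ⟨n, hn⟩ := Complex.exp_eq_one_iff.mp (sub_eq_zero.mp h0)
    exact hx (by simp [hn, h n hn])

/-- The real coordinate `a` of `x = 2πi (a + b τ)`. -/
noncomputable def coordA (τ x : ℂ) : ℝ :=
  (x / (2 * π * Complex.I)).re - (x / (2 * π * Complex.I)).im / τ.im * τ.re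

/-- The real coordinate `b` of `x = 2πi (a + b τ)`. -/
noncomputable def coordB (τ x : ℂ) : ℝ := (x / (2 * π * Complex.I)).im / τ.im

theorem eq_coord {τ : ℂ} (hτ : 0 < τ.im) (x : ℂ) :
    x = coordA τ x * (2 * π * Complex.I) + coordB τ x * (2 * π * Complex.I * τ) := by
  have h : x / (2 * π * Complex.I) = coordA τ x + coordB τ x * τ := by
    apply Complex.ext
    · simp [coordA, coordB]
    · simp only [coordA, coordB, Complex.add_im, Complex.ofReal_im, Complex.mul_im,
        Complex.ofReal_re]
      field_simp
      ring
  rw [div_eq_iff Complex.two_pi_I_ne_zero] at h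
  linear_combination h

theorem coord_apply {τ : ℂ} (hτ : 0 < τ.im) (s t : ℝ) :
    coordA τ (s * (2 * π * Complex.I) + t * (2 * π * Complex.I * τ)) = s ∧
    coordB τ (s * (2 * π * Complex.I) + t * (2 * π * Complex.I * τ)) = t := by
  have h : (s * (2 * π * Complex.I) + t * (2 * π * Complex.I * τ)) / (2 * π * Complex.I) =
      s + t * τ := by
    rw [div_eq_iff Complex.two_pi_I_ne_zero]
    ring
  have hτ' := hτ.ne'
  constructor <;> simp [coordA, coordB, h, hτ']

theorem re_eq_coordB {τ : ℂ} (hτ : 0 < τ.im) (x : ℂ) : x.re = -(2 * π * coordB τ x * τ.im) := by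
  conv_lhs => rw [eq_coord hτ x]
  simp
  ring

theorem re_div_eq_coordA {τ : ℂ} (hτ : 0 < τ.im) (x : ℂ) :
    (x / τ).re = 2 * π * coordA τ x * (τ.im / Complex.normSq τ) := by
  have hτ0 : τ ≠ 0 := fun h => by simp [h] at hτ
  have h : x / τ = (2 * π * coordA τ x : ℝ) * (Complex.I * τ⁻¹) +
      (2 * π * coordB τ x : ℝ) * Complex.I := by
    conv_lhs => rw [eq_coord hτ x]
    push_cast
    field_simp
  rw [h, Complex.add_re, Complex.re_ofReal_mul, Complex.re_ofReal_mul]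
  simp [Complex.inv_im]
  ring

theorem norm_cexp_lt_one {s : ℂ} (h : s.re < 0) : ‖Complex.exp s‖ < 1 := by
  rw [Complex.norm_exp, Real.exp_lt_one_iff]
  exact h

theorem cexp_two_pi_I_mul_ne_one {t : ℝ} (ht0 : 0 < t) (ht1 : t < 1) :
    Complex.exp (2 * π * Complex.I * t) ≠ 1 := by
  intro h
  obtain ⟨n, hn⟩ := Complex.exp_eq_one_iff.mp h
  rw [mul_comm] at hn
  have hn' := mul_right_cancel₀ Complex.two_pi_I_ne_zero hn
  have hn'' : t = n := by exact_mod_cast hn'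
  rw [hn''] at ht0 ht1
  have h1 : 0 < n := by exact_mod_cast ht0
  have h2 : n < 1 := by exact_mod_cast ht1
  omega

theorem kronecker_modular {τ : ℂ} (hτ : 0 < τ.im) {t : ℝ} (ht0 : 0 < t) (ht1 : t < 1)
    {x : ℂ} (hx0 : x ≠ 0) (hxa : |coordA τ x| < 1) (hxb : |coordB τ x| < 1) :
    kronecker (Complex.exp (2 * π * Complex.I * t)) (Complex.exp (x / τ))
        (Complex.exp (2 * π * Complex.I * (-1 / τ))) =
      τ * Complex.exp (t * x) *
        kronecker (Complex.exp (2 * π * Complex.I * (τ * t))) (Complex.exp x)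
          (Complex.exp (2 * π * Complex.I * τ)) := by
  have hτ0 : τ ≠ 0 := fun h => by simp [h] at hτ
  set z₁ := Complex.exp (2 * π * Complex.I * t) with hz₁
  set z₂ := Complex.exp (2 * π * Complex.I * (τ * t)) with hz₂
  set q := Complex.exp (2 * π * Complex.I * τ) with hq
  set q' := Complex.exp (2 * π * Complex.I * (-1 / τ)) with hq'
  set T' : ℝ := τ.im / Complex.normSq τ with hT'
  have hT'0 : 0 < T' := div_pos hτ (Complex.normSq_pos.mpr hτ0)
  have hq_re : (2 * π * Complex.I * τ).re = -(2 * π * τ.im) := by simp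
  have hq'_re : (2 * π * Complex.I * (-1 / τ)).re = -(2 * π * T') := by
    rw [show 2 * π * Complex.I * (-1 / τ) = (2 * π : ℝ) * (Complex.I * (-τ⁻¹)) by
      push_cast; ring, Complex.re_ofReal_mul]
    simp [Complex.inv_im, hT']
    ring
  have hz₂_re : (2 * π * Complex.I * (τ * t)).re = -(2 * π * τ.im * t) := by
    simp; ring
  have hz₁_re : (2 * π * Complex.I * t).re = 0 := by simp
  have hπ := Real.pi_pos
  have hq1 : ‖q‖ < 1 := norm_cexp_lt_one (by rw [hq_re]; nlinarith [mul_pos hπ hτ])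
  have hq'1 : ‖q'‖ < 1 := norm_cexp_lt_one (by rw [hq'_re]; nlinarith [mul_pos hπ hT'0])
  have hq0 : q ≠ 0 := Complex.exp_ne_zero _
  have hq'0 : q' ≠ 0 := Complex.exp_ne_zero _
  have hz₁0 : z₁ ≠ 0 := Complex.exp_ne_zero _
  have hz₂0 : z₂ ≠ 0 := Complex.exp_ne_zero _
  have hz₁n : ‖z₁‖ = 1 := by rw [hz₁, Complex.norm_exp, hz₁_re, Real.exp_zero]
  have hz₁1 : z₁ ≠ 1 := cexp_two_pi_I_mul_ne_one ht0 ht1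
  have hz₂lt : ‖z₂‖ < 1 :=
    norm_cexp_lt_one (by rw [hz₂_re]; nlinarith [mul_pos (mul_pos hπ hτ) ht0])
  have hz₂1 : z₂ ≠ 1 := fun h => by simp [h] at hz₂lt
  have hz₁q : ‖z₁ * q'‖ < 1 := by rwa [norm_mul, hz₁n, one_mul]
  have hz₁q' : ‖z₁⁻¹ * q'‖ < 1 := by rwa [norm_mul, norm_inv, hz₁n, inv_one, one_mul]
  have hz₂q : ‖z₂ * q‖ < 1 := by
    rw [hz₂, hq, ← Complex.exp_add]
    refine norm_cexp_lt_one ?_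
    rw [Complex.add_re, hz₂_re, hq_re]
    nlinarith [mul_pos (mul_pos hπ hτ) ht0, mul_pos hπ hτ]
  have hz₂q' : ‖z₂⁻¹ * q‖ < 1 := by
    rw [hz₂, hq, ← Complex.exp_neg, ← Complex.exp_add]
    refine norm_cexp_lt_one ?_
    rw [Complex.add_re, Complex.neg_re, hz₂_re, hq_re]
    nlinarith [mul_pos (mul_pos hπ hτ) (sub_pos.mpr ht1)]
  have hA := re_div_eq_coordA hτ
  have hB := re_eq_coordB hτ
  have hw₁ : ∀ x, coordA τ x < 1 → ‖Complex.exp (x / τ) * q'‖ < 1 := by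
    intro x hx
    rw [hq', ← Complex.exp_add]
    refine norm_cexp_lt_one ?_
    rw [Complex.add_re, hq'_re, hA]
    nlinarith [mul_pos (mul_pos hπ hT'0) (sub_pos.mpr hx)]
  have hw₁' : ∀ x, -1 < coordA τ x → ‖(Complex.exp (x / τ))⁻¹ * q'‖ < 1 := by
    intro x hx
    rw [hq', ← Complex.exp_neg, ← Complex.exp_add]
    refine norm_cexp_lt_one ?_
    rw [Complex.add_re, Complex.neg_re, hq'_re, hA]
    nlinarith [mul_pos (mul_pos hπ hT'0) (sub_pos.mpr hx)]
  have hw₂ : ∀ x, -1 < coordB τ x → ‖Complex.exp x * q‖ < 1 := by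
    intro x hx
    rw [hq, ← Complex.exp_add]
    refine norm_cexp_lt_one ?_
    rw [Complex.add_re, hq_re, hB]
    nlinarith [mul_pos (mul_pos hπ hτ) (sub_pos.mpr hx)]
  have hw₂' : ∀ x, coordB τ x < 1 → ‖(Complex.exp x)⁻¹ * q‖ < 1 := by
    intro x hx
    rw [hq, ← Complex.exp_neg, ← Complex.exp_add]
    refine norm_cexp_lt_one ?_
    rw [Complex.add_re, Complex.neg_re, hq_re, hB]
    nlinarith [mul_pos (mul_pos hπ hτ) (sub_pos.mpr hx)]
  set P : Set ℂ := {x | |coordA τ x| < 1 ∧ |coordB τ x| < 1} with hP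
  have hca : Continuous (coordA τ) := by unfold coordA; fun_prop
  have hcb : Continuous (coordB τ) := by unfold coordB; fun_prop
  have hcoord0 : coordA τ 0 = 0 ∧ coordB τ 0 = 0 := by simp [coordA, coordB]
  have hPo : IsOpen P :=
    (isOpen_lt hca.abs continuous_const).inter (isOpen_lt hcb.abs continuous_const)
  have hP0 : P ∈ 𝓝 (0 : ℂ) := hPo.mem_nhds ⟨by simp [hcoord0], by simp [hcoord0]⟩
  have hint : ∀ n : ℤ, |(n : ℝ)| < 1 → n = 0 := by
    intro n hn
    have : |n| < 1 := by exact_mod_cast hn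
    exact Int.abs_lt_one_iff.mp this
  have hψ₁ : ∀ x ∈ P, expQuot (x / τ) ≠ 0 := by
    rintro x ⟨-, hx⟩
    refine expQuot_ne_zero fun n hn => hint n ?_
    have h := (coord_apply hτ 0 n).2
    rw [div_eq_iff hτ0] at hn
    rw [show ((0 : ℝ) : ℂ) * (2 * π * Complex.I) + (n : ℝ) * (2 * π * Complex.I * τ) = x by
      rw [hn]; push_cast; ring] at h
    rwa [h] at hx
  have hψ₂ : ∀ x ∈ P, expQuot x ≠ 0 := by
    rintro x ⟨hx, -⟩
    refine expQuot_ne_zero fun n hn => hint n ?_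
    have h := (coord_apply hτ n 0).1
    rw [show ((n : ℝ) : ℂ) * (2 * π * Complex.I) + (0 : ℝ) * (2 * π * Complex.I * τ) = x by
      rw [hn]; push_cast; ring] at h
    rwa [h] at hx
  let N : ℂ → ℂ := fun x => (expQuot (x / τ))⁻¹ - Complex.exp (t * x) * (expQuot x)⁻¹
  have hN0 : N 0 = 0 := by simp [N, expQuot_zero]
  have hNd : DifferentiableOn ℂ N P := by
    intro x hx
    have h1 := hψ₁ x hx
    have h2 := hψ₂ x hx
    have h3 := differentiable_expQuot
    exact DifferentiableAt.differentiableWithinAt (by fun_prop (disch := assumption))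
  let g : ℂ → ℂ := fun x =>
    (z₁ / (z₁ - 1) - lambert z₁ (Complex.exp (x / τ)) q' +
        lambert z₁⁻¹ (Complex.exp (x / τ))⁻¹ q') -
      τ * Complex.exp (t * x) *
        (z₂ / (z₂ - 1) - lambert z₂ (Complex.exp x) q + lambert z₂⁻¹ (Complex.exp x)⁻¹ q) +
      τ * dslope N 0 x
  have hgd : DifferentiableOn ℂ g P := by
    have hL : ∀ {z q : ℂ} {f : ℂ → ℂ} {x : ℂ}, q ≠ 0 → ‖q‖ < 1 → ‖z * q‖ < 1 →
        DifferentiableAt ℂ f x → ‖f x * q‖ < 1 →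
        DifferentiableAt ℂ (fun x => lambert z (f x) q) x :=
      fun h0 h1 h2 hf h3 => (differentiableAt_lambert h0 h1 h2 h3).comp _ hf
    have hds : DifferentiableOn ℂ (dslope N 0) P :=
      (Complex.differentiableOn_dslope hP0).mpr hNd
    intro x hx
    have hxA := abs_lt.mp hx.1
    have hxB := abs_lt.mp hx.2
    have hd0 := hds.differentiableAt (hPo.mem_nhds hx)
    have hne1 := Complex.exp_ne_zero (x / τ)
    have hne2 := Complex.exp_ne_zero x
    have hd1 := hL hq'0 hq'1 hz₁q (f := fun x => Complex.exp (x / τ)) (by fun_prop)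
      (hw₁ x hxA.2)
    have hd2 := hL hq'0 hq'1 hz₁q' (f := fun x => (Complex.exp (x / τ))⁻¹)
      (by fun_prop (disch := assumption)) (hw₁' x hxA.1)
    have hd3 := hL hq0 hq1 hz₂q (f := fun x => Complex.exp x) (by fun_prop) (hw₂ x hxB.1)
    have hd4 := hL hq0 hq1 hz₂q' (f := fun x => (Complex.exp x)⁻¹)
      (by fun_prop (disch := assumption)) (hw₂' x hxB.2)
    exact DifferentiableAt.differentiableWithinAt (by fun_prop)
  have hg : ∀ x ∈ P, x ≠ 0 → g x = kronecker z₁ (Complex.exp (x / τ)) q' -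
      τ * Complex.exp (t * x) * kronecker z₂ (Complex.exp x) q := by
    intro x hx hx0
    have h1 := hψ₁ x hx
    have h2 := hψ₂ x hx
    have hxτ : x / τ ≠ 0 := div_ne_zero hx0 hτ0
    have he : dslope N 0 x = N x / x := by
      rw [dslope_of_ne _ hx0, slope_def_field, hN0, sub_zero, sub_zero]
    have e1 : Complex.exp (x / τ) - 1 = expQuot (x / τ) * (x / τ) := by
      rw [expQuot_of_ne hxτ, div_mul_cancel₀ _ hxτ]
    have e2 : Complex.exp x - 1 = expQuot x * x := by
      rw [expQuot_of_ne hx0, div_mul_cancel₀ _ hx0]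
    simp only [g, kronecker, he, N, e1, e2]
    field_simp
    ring
  have hgz := eq_zero_of_quasiperiodic (g := g) (c₁ := z₁) (c₂ := 1) hca hcb (eq_coord hτ)
    (fun s t => (coord_apply hτ s t).1) (fun s t => (coord_apply hτ s t).2) hgd hz₁n hz₁1
    norm_one ?_ ?_ x hxa hxb
  · rw [hg x ⟨hxa, hxb⟩ hx0] at hgz
    exact sub_eq_zero.mp hgz
  · intro x ha ha' hb
    have hadd : coordA τ (x + 2 * π * Complex.I) = coordA τ x + 1 ∧
        coordB τ (x + 2 * π * Complex.I) = coordB τ x := by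
      have h := coord_apply hτ (coordA τ x + 1) (coordB τ x)
      rwa [show ((coordA τ x + 1 : ℝ) : ℂ) * (2 * π * Complex.I) +
        coordB τ x * (2 * π * Complex.I * τ) = x + 2 * π * Complex.I by
          push_cast; linear_combination -eq_coord hτ x] at h
    have hxP : x ∈ P := ⟨abs_lt.mpr ⟨ha, by linarith⟩, hb⟩
    have hx0 : x ≠ 0 := by
      rintro rfl
      rw [hcoord0.1] at ha'
      exact lt_irrefl _ ha'
    have hxP' : x + 2 * π * Complex.I ∈ P := by
      refine ⟨abs_lt.mpr ?_, ?_⟩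
      · rw [hadd.1]; constructor <;> linarith
      · rwa [hadd.2]
    have hx0' : x + 2 * π * Complex.I ≠ 0 := by
      intro h
      have := hadd.1
      rw [h, hcoord0.1] at this
      linarith
    have hwq : Complex.exp ((x + 2 * π * Complex.I) / τ) * q' = Complex.exp (x / τ) := by
      rw [hq', ← Complex.exp_add]
      congr 1
      ring
    have hk := kronecker_mul_q (w := Complex.exp ((x + 2 * π * Complex.I) / τ))
      hz₁0 hz₁1 hq'0 hq'1 hz₁q hz₁q' ?_ ?_
    · rw [hwq] at hk
      rw [hg _ hxP hx0, hg _ hxP' hx0', hk, Complex.exp_add x, Complex.exp_two_pi_mul_I, mul_one,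
        show (t : ℂ) * (x + 2 * π * Complex.I) = t * x + 2 * π * Complex.I * t by ring,
        Complex.exp_add, ← hz₁]
      field_simp
    · rw [Complex.norm_exp, Real.one_lt_exp_iff, hA, hadd.1]
      have : 0 < coordA τ x + 1 := by linarith
      positivity
    · exact hw₁ _ (by rw [hadd.1]; linarith)
  · intro x ha hb hb'
    have hadd : coordA τ (x + 2 * π * Complex.I * τ) = coordA τ x ∧
        coordB τ (x + 2 * π * Complex.I * τ) = coordB τ x + 1 := by
      have h := coord_apply hτ (coordA τ x) (coordB τ x + 1)
      rwa [show (coordA τ x : ℂ) * (2 * π * Complex.I) +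
        ((coordB τ x + 1 : ℝ) : ℂ) * (2 * π * Complex.I * τ) = x + 2 * π * Complex.I * τ by
          push_cast; linear_combination -eq_coord hτ x] at h
    have hxP : x ∈ P := ⟨ha, abs_lt.mpr ⟨hb, by linarith⟩⟩
    have hx0 : x ≠ 0 := by
      rintro rfl
      rw [hcoord0.2] at hb'
      exact lt_irrefl _ hb'
    have hxP' : x + 2 * π * Complex.I * τ ∈ P := by
      refine ⟨?_, abs_lt.mpr ?_⟩
      · rwa [hadd.1]
      · rw [hadd.2]; constructor <;> linarith
    have hx0' : x + 2 * π * Complex.I * τ ≠ 0 := by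
      intro h
      have := hadd.2
      rw [h, hcoord0.2] at this
      linarith
    have hk := kronecker_mul_q (w := Complex.exp x) hz₂0 hz₂1 hq0 hq1 hz₂q hz₂q' ?_
      (hw₂ x hb)
    · rw [hg _ hxP hx0, hg _ hxP' hx0', Complex.exp_add x, ← hq, hk,
        show (x + 2 * π * Complex.I * τ) / τ = x / τ + 2 * π * Complex.I by field_simp,
        Complex.exp_add (x / τ), Complex.exp_two_pi_mul_I, mul_one,
        show (t : ℂ) * (x + 2 * π * Complex.I * τ) = t * x + 2 * π * Complex.I * (τ * t) by ring,
        Complex.exp_add, ← hz₂]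
      field_simp
    · rw [Complex.norm_exp, Real.one_lt_exp_iff, hB]
      have := mul_pos (mul_pos hπ hτ) (neg_pos.mpr hb')
      linarith

theorem summable_lambertCoeff {z q : ℂ} (hq1 : ‖q‖ < 1) (hzq : ‖z * q‖ < 1) (n : ℕ) :
    Summable fun mp : ℕ × ℕ =>
      z ^ (mp.1 + 1) * ((mp.2 : ℂ) + 1) ^ n * q ^ ((mp.1 + 1) * (mp.2 + 1)) := by
  obtain ⟨x, hx, hx0⟩ := (((eventually_exp_norm_mul_lt_one hq1).filter_mono
    nhdsWithin_le_nhds).and (self_mem_nhdsWithin (s := {(0 : ℂ)}ᶜ))).exists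
  have hx0' : x ≠ 0 := hx0
  have hs := ((summable_lambert_exp hq1 hzq hx).prod_symm.prod_factor n).mul_right
    ((n ! : ℂ) / x ^ n)
  refine hs.congr fun mp => ?_
  have hn : (n ! : ℂ) ≠ 0 := by exact_mod_cast n.factorial_ne_zero
  simp only [Prod.swap_prod_mk, mul_pow]
  field_simp

theorem hasExpansion_kronecker {ξ τ : ℂ} (hz1 : Complex.exp (2 * π * Complex.I * ξ) ≠ 1)
    (hq1 : ‖Complex.exp (2 * π * Complex.I * τ)‖ < 1)
    (hzq : ‖Complex.exp (2 * π * Complex.I * ξ) * Complex.exp (2 * π * Complex.I * τ)‖ < 1)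
    (hzq' : ‖(Complex.exp (2 * π * Complex.I * ξ))⁻¹ * Complex.exp (2 * π * Complex.I * τ)‖ < 1) :
    HasExpansion (fun x => x * (2 * π * Complex.I *
      kronecker (Complex.exp (2 * π * Complex.I * ξ)) (Complex.exp x)
        (Complex.exp (2 * π * Complex.I * τ)))) (PowerSeries.mk fun n => fKr n ξ τ) := by
  have hzm : ∀ m : ℕ, Complex.exp (2 * π * Complex.I * ((m : ℂ) + 1) * ξ) =
      Complex.exp (2 * π * Complex.I * ξ) ^ (m + 1) := by
    intro m
    rw [← Complex.exp_nat_mul]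
    push_cast
    ring_nf
  have hzm' : ∀ m : ℕ, Complex.exp (-(2 * π * Complex.I * ((m : ℂ) + 1) * ξ)) =
      (Complex.exp (2 * π * Complex.I * ξ))⁻¹ ^ (m + 1) := by
    intro m
    rw [Complex.exp_neg, hzm, inv_pow]
  have hcot : π * Complex.cot (π * ξ) = 2 * π * Complex.I *
      (Complex.exp (2 * π * Complex.I * ξ) / (Complex.exp (2 * π * Complex.I * ξ) - 1) - 1 / 2) := by
    rw [Complex.cot_eq_exp_ratio,
      show 2 * Complex.I * (π * ξ) = 2 * π * Complex.I * ξ by ring]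
    have h1 : Complex.exp (2 * π * Complex.I * ξ) - 1 ≠ 0 := sub_ne_zero.mpr hz1
    rw [← neg_sub (Complex.exp (2 * π * Complex.I * ξ)) 1]
    generalize Complex.exp (2 * π * Complex.I * ξ) = E at h1 ⊢
    field_simp
    rw [Complex.I_sq]
    ring
  have hf0 : fKr 0 ξ τ = 2 * π * Complex.I := by simp [fKr]
  set z := Complex.exp (2 * π * Complex.I * ξ) with hz
  set q := Complex.exp (2 * π * Complex.I * τ) with hq
  have hf1 : fKr 1 ξ τ = 2 * π * Complex.I * (z / (z - 1) - 1 / 2) - 2 * π * Complex.I *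
      (lambertCoeff z q 0 - lambertCoeff z⁻¹ q 0) := by
    rw [lambertCoeff, lambertCoeff, ← (summable_lambertCoeff hq1 hzq 0).tsum_sub
      (summable_lambertCoeff hq1 hzq' 0), fKr, hcot]
    congr 2
    refine tsum_congr fun mp => ?_
    rw [hzm, hzm', pow_zero, ← hq]
    ring
  have hf2 : ∀ n, fKr (n + 2) ξ τ = (2 * π * Complex.I / ((n + 1)! : ℂ)) *
      ((bernoulli (n + 2) : ℂ) / ((n : ℂ) + 2) -
        (lambertCoeff z q (n + 1) + (-1) ^ (n + 2) * lambertCoeff z⁻¹ q (n + 1))) := by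
    intro n
    rw [lambertCoeff, lambertCoeff, ← tsum_mul_left, ← (summable_lambertCoeff hq1 hzq _).tsum_add
      ((summable_lambertCoeff hq1 hzq' _).mul_left _), fKr]
    congr 2
    refine tsum_congr fun mp => ?_
    rw [hzm, hzm', ← hq]
    ring
  have hE := (HasExpansion.const (2 * π * Complex.I)).mul
    ((((HasExpansion.id.mul (HasExpansion.const (z / (z - 1)))).add hasExpansion_bernoulli).sub
      (HasExpansion.id.mul (hasExpansion_lambert hq1 hzq))).add
      (HasExpansion.id.mul ((hasExpansion_lambert hq1 hzq').comp_mul_left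
        (c := -1) (neg_ne_zero.mpr one_ne_zero))))
  have hp : PowerSeries.C (2 * π * Complex.I) *
      (PowerSeries.X * PowerSeries.C (z / (z - 1)) + bernoulliPowerSeries ℂ -
        PowerSeries.X * (PowerSeries.mk fun n => lambertCoeff z q n / (n ! : ℂ)) +
        PowerSeries.X * PowerSeries.rescale (-1)
          (PowerSeries.mk fun n => lambertCoeff z⁻¹ q n / (n ! : ℂ))) =
      PowerSeries.mk fun n => fKr n ξ τ := by
    ext n
    rw [PowerSeries.coeff_C_mul, PowerSeries.coeff_mk]
    rcases n with _ | _ | n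
    · rw [hf0]
      simp [bernoulliPowerSeries]
    · rw [hf1]
      simp [bernoulliPowerSeries, PowerSeries.coeff_succ_X_mul, PowerSeries.coeff_rescale]
      ring
    · rw [hf2]
      have hn : ((n + 1)! : ℂ) ≠ 0 := by exact_mod_cast (n + 1).factorial_ne_zero
      have hn' : (n : ℂ) + 2 ≠ 0 := by exact_mod_cast (n + 1).succ_ne_zero
      have hfac : ((n + 1 + 1)! : ℂ) = ((n : ℂ) + 2) * ((n + 1)! : ℂ) := by
        rw [Nat.factorial_succ (n + 1)]
        push_cast
        ring
      simp only [map_add, map_sub, PowerSeries.coeff_succ_X_mul, PowerSeries.coeff_rescale,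
        PowerSeries.coeff_mk, bernoulliPowerSeries, PowerSeries.coeff_C, map_div₀, map_natCast,
        eq_ratCast]
      rw [hfac, if_neg (by omega)]
      field_simp
      ring
  rw [hp] at hE
  refine hE.congr (Eventually.of_forall fun x => ?_)
  rw [kronecker, neg_one_mul, Complex.exp_neg]
  ring

theorem hasExpansion_kronecker_of_im {ξ τ : ℂ} (hξ : |ξ.im| < τ.im)
    (hz1 : Complex.exp (2 * π * Complex.I * ξ) ≠ 1) :
    HasExpansion (fun x => x * (2 * π * Complex.I *
      kronecker (Complex.exp (2 * π * Complex.I * ξ)) (Complex.exp x)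
        (Complex.exp (2 * π * Complex.I * τ)))) (PowerSeries.mk fun n => fKr n ξ τ) := by
  have hre : ∀ s : ℂ, (2 * π * Complex.I * s).re = -(2 * π * s.im) := fun s => by simp
  have hπ := Real.pi_pos
  obtain ⟨h1, h2⟩ := abs_lt.mp hξ
  refine hasExpansion_kronecker hz1 (norm_cexp_lt_one ?_) ?_ ?_
  · rw [hre]
    nlinarith
  · rw [← Complex.exp_add]
    refine norm_cexp_lt_one ?_
    rw [Complex.add_re, hre, hre]
    nlinarith
  · rw [← Complex.exp_neg, ← Complex.exp_add]
    refine norm_cexp_lt_one ?_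
    rw [Complex.add_re, Complex.neg_re, hre, hre]
    nlinarith

theorem fKr_modular {τ : ℂ} (hτ : 0 < τ.im) {t : ℝ} (ht0 : 0 < t) (ht1 : t < 1) (n : ℕ) :
    fKr n t (-1 / τ) = τ ^ n * omKr n (τ * t) τ := by
  have hτ0 : τ ≠ 0 := fun h => by simp [h] at hτ
  have him : (τ * t).im = τ.im * t := by simp
  have him' : 0 < (-1 / τ).im := by
    rw [show (-1 / τ).im = τ.im / Complex.normSq τ by simp [neg_div, Complex.inv_im]]
    exact div_pos hτ (Complex.normSq_pos.mpr hτ0)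
  have hz₂ : Complex.exp (2 * π * Complex.I * (τ * t)) ≠ 1 := by
    intro h
    have hlt : ‖Complex.exp (2 * π * Complex.I * (τ * t))‖ < 1 := by
      refine norm_cexp_lt_one ?_
      have : (2 * π * Complex.I * (τ * t)).re = -(2 * π * (τ.im * t)) := by simp
      rw [this]
      have := Real.pi_pos
      exact neg_neg_of_pos (by positivity)
    simp [h] at hlt
  have e₁ := (hasExpansion_kronecker_of_im (ξ := t) (τ := -1 / τ) (by simpa using him')
    (cexp_two_pi_I_mul_ne_one ht0 ht1)).comp_mul_left (inv_ne_zero hτ0)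
  have e₂ := (HasExpansion.exp.comp_mul_left (c := (t : ℂ)) (by exact_mod_cast ht0.ne')).mul
    (hasExpansion_kronecker_of_im (ξ := τ * t) (τ := τ)
      (by rw [him, abs_of_pos (by positivity)]; nlinarith) hz₂)
  have hca : Continuous fun x => |coordA τ x| := by unfold coordA; fun_prop
  have hcb : Continuous fun x => |coordB τ x| := by unfold coordB; fun_prop
  have hev : ∀ᶠ x in 𝓝[≠] (0 : ℂ), |coordA τ x| < 1 ∧ |coordB τ x| < 1 := by
    refine Filter.Eventually.filter_mono nhdsWithin_le_nhds (Filter.Eventually.and ?_ ?_)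
    · exact hca.continuousAt.eventually_lt continuousAt_const (by simp [coordA])
    · exact hcb.continuousAt.eventually_lt continuousAt_const (by simp [coordB])
  have hcoeff := congrArg (PowerSeries.coeff n) (e₁.unique (e₂.congr ?_))
  · rw [PowerSeries.coeff_rescale, PowerSeries.coeff_mk, PowerSeries.coeff_mul,
      Finset.Nat.sum_antidiagonal_eq_sum_range_succ_mk, inv_pow,
      inv_mul_eq_iff_eq_mul₀ (pow_ne_zero n hτ0)] at hcoeff
    rw [hcoeff, omKr]
    congr 1
    refine Finset.sum_congr rfl fun k _ => ?_
    rw [PowerSeries.coeff_rescale, PowerSeries.coeff_mk, PowerSeries.coeff_exp, him,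
      mul_div_cancel_left₀ _ hτ.ne']
    simp [div_eq_mul_inv]
  · filter_upwards [hev, self_mem_nhdsWithin] with x hx hx0
    rw [← div_eq_inv_mul, kronecker_modular hτ ht0 ht1 hx0 hx.1 hx.2]
    field_simp

theorem fKr_add_one (n : ℕ) (ξ τ : ℂ) : fKr n ξ (τ + 1) = fKr n ξ τ := by
  have h : Complex.exp (2 * π * Complex.I * (τ + 1)) = Complex.exp (2 * π * Complex.I * τ) := by
    rw [mul_add, mul_one, Complex.exp_add, Complex.exp_two_pi_mul_I, mul_one]
  rcases n with _ | _ | n <;> simp only [fKr, h]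

theorem measurableSet_openSimplex (r : ℕ) : MeasurableSet (openSimplex r) := by
  have h : openSimplex r = (⋂ i, {t | 0 < t i} ∩ {t | t i < 1}) ∩
      ⋂ i, ⋂ j, ⋂ _ : i < j, {t : Fin r → ℝ | t j < t i} := by
    ext t
    simp [openSimplex]
  rw [h]
  refine (MeasurableSet.iInter fun i => ?_).inter
    (MeasurableSet.iInter fun i => MeasurableSet.iInter fun j => MeasurableSet.iInter fun _ => ?_)
  · exact (measurableSet_lt (by fun_prop) (by fun_prop)).inter
      (measurableSet_lt (by fun_prop) (by fun_prop))
  · exact measurableSet_lt (by fun_prop) (by fun_prop)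

/-- For an admissible tuple (first and last entry `≠ 1`) and `τ ∈ ℍ`:
`A(n₁,…,n_r;τ+1) = A(n₁,…,n_r;τ)` and `A(n₁,…,n_r;−1/τ) = B(n₁,…,n_r;τ)`. -/
theorem Aell_T_invariant_and_S_eq_Bell (r : ℕ) (hr : 1 ≤ r) (n : Fin r → ℕ)
    (h1 : n ⟨0, hr⟩ ≠ 1) (h2 : n ⟨r - 1, by omega⟩ ≠ 1)
    (τ : ℂ) (hτ : 0 < τ.im) :
    Aell n (τ + 1) = Aell n τ ∧ Aell n (-1 / τ) = Bell n τ := by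
  refine ⟨by simp only [Aell, fKr_add_one], ?_⟩
  rw [Aell, Bell, ← integral_const_mul]
  refine setIntegral_congr_fun (measurableSet_openSimplex r) fun t ht => ?_
  rw [← Finset.prod_pow_eq_pow_sum, ← Finset.prod_mul_distrib]
  exact Finset.prod_congr rfl fun i _ => fKr_modular hτ (ht.1 i).1 (ht.1 i).2 (n i)
end

section
/- For all r ≥ 1 and n₁,…,n_r ∈ ℤ_{≥0} with n₁ ≠ 1 and n_r ≠ 1, and for all τ ∈ ℍ: A(n₁,…,n_r;τ) = (−1)^{n₁+⋯+n_r} · A(n_r,…,n₁;τ). In particular A(n;τ) = 0 for every odd n ≥ 2. -/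
open scoped Real Nat
open Finset MeasureTheory

/-- Reflecting the argument exchanges the two exponentials in the `q`-expansions of `fKr`. -/
theorem exp_two_pi_mul_one_sub (m : ℕ) (ξ : ℂ) :
    Complex.exp (2 * ↑π * Complex.I * ((m : ℂ) + 1) * (1 - ξ)) =
      Complex.exp (-(2 * ↑π * Complex.I * ((m : ℂ) + 1) * ξ)) := by
  rw [Complex.exp_eq_exp_iff_exists_int]
  exact ⟨m + 1, by push_cast; ring⟩

theorem exp_neg_two_pi_mul_one_sub (m : ℕ) (ξ : ℂ) :
    Complex.exp (-(2 * ↑π * Complex.I * ((m : ℂ) + 1) * (1 - ξ))) =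
      Complex.exp (2 * ↑π * Complex.I * ((m : ℂ) + 1) * ξ) := by
  rw [Complex.exp_eq_exp_iff_exists_int]
  exact ⟨-(m + 1), by push_cast; ring⟩

theorem cot_pi_mul_one_sub (ξ : ℂ) :
    Complex.cot (↑π * (1 - ξ)) = -Complex.cot (↑π * ξ) := by
  rw [mul_sub, mul_one, Complex.cot, Complex.cot, Complex.cos_pi_sub, Complex.sin_pi_sub, neg_div]

theorem neg_one_pow_mul_bernoulli (n : ℕ) :
    (-1 : ℂ) ^ (n + 2) * (bernoulli (n + 2) : ℂ) = (bernoulli (n + 2) : ℂ) := by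
  rcases Nat.even_or_odd (n + 2) with h | h
  · rw [h.neg_one_pow, one_mul]
  · rw [bernoulli_eq_zero_of_odd h (by omega), Rat.cast_zero, mul_zero]

/-- Parity and periodicity: `f_n(1 - ξ, τ) = (-1)^n f_n(ξ, τ)`. -/
theorem fKr_one_sub (n : ℕ) (ξ τ : ℂ) :
    fKr n (1 - ξ) τ = (-1 : ℂ) ^ n * fKr n ξ τ := by
  match n with
  | 0 => simp [fKr]
  | 1 =>
    simp only [fKr, cot_pi_mul_one_sub, exp_two_pi_mul_one_sub, exp_neg_two_pi_mul_one_sub]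
    simp_rw [← neg_sub (Complex.exp (2 * ↑π * Complex.I * _ * ξ)), neg_mul, tsum_neg]
    ring
  | n + 2 =>
    simp only [fKr, exp_two_pi_mul_one_sub, exp_neg_two_pi_mul_one_sub]
    have hsq : (-1 : ℂ) ^ (n + 2) * (-1 : ℂ) ^ (n + 2) = 1 := by
      rw [← mul_pow]; simp
    rw [mul_left_comm, mul_sub ((-1 : ℂ) ^ (n + 2)), ← mul_div_assoc ((-1 : ℂ) ^ (n + 2)),
      neg_one_pow_mul_bernoulli, ← tsum_mul_left]
    congr 2
    refine tsum_congr fun mp => ?_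
    linear_combination
      (-(Complex.exp (-(2 * ↑π * Complex.I * ((mp.1 : ℂ) + 1) * ξ))) *
        ((mp.2 : ℂ) + 1) ^ (n + 1) *
        Complex.exp (2 * ↑π * Complex.I * τ) ^ ((mp.1 + 1) * (mp.2 + 1))) * hsq

/-- The reflection `t ↦ (1 - t_r, …, 1 - t_1)` as a measurable equivalence. -/
noncomputable def reflectRev (r : ℕ) : (Fin r → ℝ) ≃ᵐ (Fin r → ℝ) :=
  (MeasurableEquiv.piCongrLeft (fun _ : Fin r => ℝ) Fin.revPerm).trans
    (MeasurableEquiv.subLeft (1 : Fin r → ℝ))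

theorem reflectRev_apply {r : ℕ} (t : Fin r → ℝ) (i : Fin r) :
    reflectRev r t i = 1 - t (Fin.rev i) := by
  have h := Equiv.piCongrLeft_apply_apply (fun _ : Fin r => ℝ) Fin.revPerm t (Fin.rev i)
  rw [Fin.revPerm_apply, Fin.rev_rev] at h
  simp only [reflectRev, MeasurableEquiv.trans_apply, MeasurableEquiv.coe_piCongrLeft]
  exact congrArg (1 - ·) h

theorem measurePreserving_reflectRev (r : ℕ) : MeasurePreserving (reflectRev r) :=
  (Measure.measurePreserving_sub_left volume (1 : Fin r → ℝ)).comp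
    (volume_measurePreserving_piCongrLeft (fun _ : Fin r => ℝ) Fin.revPerm)

theorem reflectRev_preimage_openSimplex (r : ℕ) :
    reflectRev r ⁻¹' openSimplex r = openSimplex r := by
  ext t
  simp only [openSimplex, Set.mem_preimage, Set.mem_ofPred_eq, reflectRev_apply]
  constructor
  · rintro ⟨h, h'⟩
    refine ⟨fun i => ?_, fun i j hij => ?_⟩
    · have := h (Fin.rev i)
      rw [Fin.rev_rev] at this
      constructor <;> linarith [this.1, this.2]
    · have := h' _ _ (Fin.rev_lt_rev.mpr hij)
      rw [Fin.rev_rev, Fin.rev_rev] at this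
      linarith
  · rintro ⟨h, h'⟩
    refine ⟨fun i => ?_, fun i j hij => ?_⟩
    · constructor <;> linarith [(h (Fin.rev i)).1, (h (Fin.rev i)).2]
    · linarith [h' _ _ (Fin.rev_lt_rev.mpr hij)]

theorem Aell_eq_neg_one_pow_mul_Aell_rev {r : ℕ} (n : Fin r → ℕ) (τ : ℂ) :
    Aell n τ = (-1 : ℂ) ^ (∑ i, n i) * Aell (fun i => n (Fin.rev i)) τ := by
  rw [Aell, ← (measurePreserving_reflectRev r).setIntegral_preimage_emb
    (reflectRev r).measurableEmbedding, reflectRev_preimage_openSimplex, Aell,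
    ← integral_const_mul]
  congr 1
  funext t
  simp only [reflectRev_apply, Complex.ofReal_sub, Complex.ofReal_one, fKr_one_sub,
    Finset.prod_mul_distrib, Finset.prod_pow_eq_pow_sum]
  congr 1
  rw [← Equiv.prod_comp Fin.revPerm]
  simp

theorem Aell_fin_one_of_odd {m : ℕ} (hm : Odd m) (τ : ℂ) :
    Aell (fun _ : Fin 1 => m) τ = 0 := by
  have h := Aell_eq_neg_one_pow_mul_Aell_rev (fun _ : Fin 1 => m) τ
  rw [Fin.sum_univ_one, hm.neg_one_pow, neg_one_mul] at h
  exact self_eq_neg.mp h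

/-- Reflection identity for A-elliptic multiple zeta values:
`A(n₁,…,n_r;τ) = (−1)^{n₁+⋯+n_r} A(n_r,…,n₁;τ)`; in particular `A(n;τ) = 0` for every odd
`n ≥ 2`. -/
theorem Aell_reversal (r : ℕ) (hr : 1 ≤ r) (n : Fin r → ℕ)
    (h1 : n ⟨0, hr⟩ ≠ 1) (h2 : n ⟨r - 1, by omega⟩ ≠ 1)
    (τ : ℂ) (hτ : 0 < τ.im) :
    Aell n τ = (-1 : ℂ) ^ (∑ i, n i) * Aell (fun i => n (Fin.rev i)) τ ∧
      ∀ m : ℕ, 2 ≤ m → Odd m → Aell (fun _ : Fin 1 => m) τ = 0 := by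
  exact ⟨Aell_eq_neg_one_pow_mul_Aell_rev n τ, fun _ _ hm => Aell_fin_one_of_odd hm τ⟩
end

section
/- For every integer n ≥ 2 and every τ ∈ ℍ, the length-one B-elliptic multiple zeta value satisfies B(n;τ) = τⁿ · ∫₀¹ ω_n(τt, τ) dt = 2πi·B_n/n!; in particular it is independent of τ and vanishes when n is odd. -/
open scoped Real Nat
open Finset MeasureTheory

/-- A series of integrable functions with summable `L¹` norms has an integrable sum. -/
theorem integrable_tsum_of_summable_integral_norm {α ι : Type*} [MeasurableSpace α] [Countable ι]
    {μ : Measure α} {F : ι → α → ℂ} (hF : ∀ i, Integrable (F i) μ)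
    (hsum : Summable fun i => ∫ a, ‖F i a‖ ∂μ) : Integrable (fun a => ∑' i, F i a) μ := by
  refine ⟨(AEMeasurable.tsum fun i => (hF i).1.aemeasurable).aestronglyMeasurable, ?_⟩
  have h (i : ι) : ∫⁻ a, ‖F i a‖ₑ ∂μ = ENNReal.ofReal (∫ a, ‖F i a‖ ∂μ) :=
    (ofReal_integral_norm_eq_lintegral_enorm (hF i)).symm
  calc ∫⁻ a, ‖∑' i, F i a‖ₑ ∂μ ≤ ∫⁻ a, ∑' i, ‖F i a‖ₑ ∂μ :=
        lintegral_mono fun a => enorm_tsum_le_tsum_enorm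
    _ = ∑' i, ENNReal.ofReal (∫ a, ‖F i a‖ ∂μ) := by
        rw [lintegral_tsum fun i => (hF i).1.enorm]
        simp only [h]
    _ < ⊤ := hsum.tsum_ofReal_lt_top

theorem tendsto_pow_mul_cexp_mul_atTop {c : ℂ} (hc : c.re < 0) (k : ℕ) :
    Filter.Tendsto (fun u : ℝ => (u : ℂ) ^ k * Complex.exp (c * u)) Filter.atTop (nhds 0) := by
  rw [tendsto_zero_iff_norm_tendsto_zero]
  refine (tendsto_rpow_mul_exp_neg_mul_atTop_nhds_zero k (-c.re) (neg_pos.2 hc)).congr' ?_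
  filter_upwards [Filter.eventually_ge_atTop 0] with u hu
  simp [Complex.norm_exp, abs_of_nonneg hu]

theorem integrableOn_pow_mul_cexp_mul {c : ℂ} (hc : c.re < 0) (k : ℕ) :
    IntegrableOn (fun u : ℝ => (u : ℂ) ^ k * Complex.exp (c * u)) (Set.Ioi 0) := by
  have h := integrableOn_rpow_mul_exp_neg_mul_rpow (p := 1) (s := k) (b := -c.re)
    (by have := k.cast_nonneg (α := ℝ); linarith) one_pos (neg_pos.2 hc)
  refine Integrable.mono' h (by fun_prop) ?_
  filter_upwards [ae_restrict_mem measurableSet_Ioi] with u hu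
  simp [Complex.norm_exp, abs_of_pos (Set.mem_Ioi.1 hu)]

theorem integral_pow_mul_cexp_mul {c : ℂ} (hc : c.re < 0) (k : ℕ) :
    ∫ u in Set.Ioi (0 : ℝ), (u : ℂ) ^ k * Complex.exp (c * u) = (k ! : ℂ) / (-c) ^ (k + 1) := by
  have hc0 : c ≠ 0 := by rintro rfl; simp at hc
  induction k with
  | zero =>
    have := integral_exp_mul_complex_Ioi hc 0
    simp [this, div_neg, neg_div]
  | succ k ih =>
    have hd (u : ℝ) : HasDerivAt (fun u : ℝ => (u : ℂ) ^ (k + 1) * Complex.exp (c * u))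
        ((k + 1) * ((u : ℂ) ^ k * Complex.exp (c * u)) +
          c * ((u : ℂ) ^ (k + 1) * Complex.exp (c * u))) u := by
      have h1 : HasDerivAt (fun u : ℂ => u ^ (k + 1) * Complex.exp (c * u))
          ((k + 1) * ((u : ℂ) ^ k * Complex.exp (c * u)) +
            c * ((u : ℂ) ^ (k + 1) * Complex.exp (c * u))) u := by
        convert! (hasDerivAt_pow (k + 1) (u : ℂ)).mul
          (((hasDerivAt_id (u : ℂ)).const_mul c).cexp) using 1
        simp
        ring
      exact h1.comp_ofReal
    have hk := (integrableOn_pow_mul_cexp_mul hc k).const_mul ((k : ℂ) + 1)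
    have hk1 := (integrableOn_pow_mul_cexp_mul hc (k + 1)).const_mul c
    have h := integral_Ioi_of_hasDerivAt_of_tendsto' (a := 0) (fun u _ => hd u) (hk.add hk1)
      (tendsto_pow_mul_cexp_mul_atTop hc (k + 1))
    rw [integral_add hk hk1, integral_const_mul, integral_const_mul, ih] at h
    have h' : c * ∫ u in Set.Ioi (0 : ℝ), (u : ℂ) ^ (k + 1) * Complex.exp (c * u) =
        -((k + 1) * ((k ! : ℂ) / (-c) ^ (k + 1))) := by
      rw [eq_neg_iff_add_eq_zero, add_comm, h]
      simp
    rw [← mul_right_inj' hc0, h', Nat.factorial_succ, pow_succ (-c) (k + 1)]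
    push_cast
    field_simp

theorem integral_norm_pow_mul_cexp_mul {c : ℂ} (hc : c.re < 0) (k : ℕ) :
    ∫ u in Set.Ioi (0 : ℝ), ‖(u : ℂ) ^ k * Complex.exp (c * u)‖ =
      (k ! : ℝ) / (-c.re) ^ (k + 1) := by
  have h := integral_pow_mul_cexp_mul (c := (c.re : ℂ)) (by simpa using hc) k
  rw [← Complex.ofReal_inj, ← integral_complex_ofReal]
  push_cast
  rw [← h]
  refine setIntegral_congr_fun measurableSet_Ioi fun u hu => ?_
  simp [Complex.norm_exp, abs_of_pos (Set.mem_Ioi.1 hu), Complex.ofReal_exp]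

theorem iUnion_Ioc_natCast_add_one : ⋃ p : ℕ, Set.Ioc (p : ℝ) (p + 1) = Set.Ioi 0 := by
  ext x
  simp only [Set.mem_iUnion, Set.mem_Ioc, Set.mem_Ioi]
  constructor
  · rintro ⟨p, hp, -⟩
    exact p.cast_nonneg.trans_lt hp
  · intro hx
    have h1 : 0 < ⌈x⌉₊ := Nat.ceil_pos.2 hx
    refine ⟨⌈x⌉₊ - 1, ?_, ?_⟩
    · rw [Nat.cast_pred h1]
      linarith [Nat.ceil_lt_add_one hx.le]
    · rw [Nat.cast_pred h1]
      linarith [Nat.le_ceil x]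

theorem pairwise_disjoint_Ioc_natCast_add_one :
    Pairwise (Function.onFun Disjoint fun p : ℕ => Set.Ioc (p : ℝ) (p + 1)) := by
  simpa using (Nat.mono_cast (α := ℝ)).pairwise_disjoint_on_Ioc_succ

theorem setIntegral_Ioo_comp_add_natCast {E : Type*} [NormedAddCommGroup E] [NormedSpace ℝ E]
    (f : ℝ → E) (p : ℕ) :
    ∫ t in Set.Ioo (0 : ℝ) 1, f (t + p) = ∫ t in Set.Ioc (p : ℝ) (p + 1), f t := by
  rw [← integral_Ioc_eq_integral_Ioo, ← intervalIntegral.integral_of_le zero_le_one,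
    intervalIntegral.integral_comp_add_right, intervalIntegral.integral_of_le (by linarith),
    zero_add, add_comm 1]

/-- The integral over the half line is the sum of the integrals of the integer translates. -/
theorem hasSum_setIntegral_Ioo_comp_add_natCast {E : Type*} [NormedAddCommGroup E]
    [NormedSpace ℝ E] {f : ℝ → E} (hf : IntegrableOn f (Set.Ioi 0)) :
    HasSum (fun p : ℕ => ∫ t in Set.Ioo (0 : ℝ) 1, f (t + p)) (∫ t in Set.Ioi 0, f t) := by
  simp only [setIntegral_Ioo_comp_add_natCast]
  rw [← iUnion_Ioc_natCast_add_one] at hf ⊢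
  exact hasSum_integral_iUnion (fun _ => measurableSet_Ioc)
    pairwise_disjoint_Ioc_natCast_add_one hf

/-- The sum `∑ (x + p)^k e^{c(m+1)(x+p)}` over `m, p ≥ 0`. -/
noncomputable def lambertSum (c : ℂ) (k : ℕ) (x : ℝ) : ℂ :=
  ∑' mp : ℕ × ℕ, ((x : ℂ) + mp.2) ^ k * Complex.exp (c * (mp.1 + 1) * (x + mp.2))

theorem re_mul_natCast_add_one_neg {c : ℂ} (hc : c.re < 0) (m : ℕ) :
    (c * ((m : ℂ) + 1)).re < 0 := by
  have : (c * ((m : ℂ) + 1)).re = c.re * (m + 1) := by simp [Complex.mul_re]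
  rw [this]
  exact mul_neg_of_neg_of_pos hc (by positivity)

theorem integrableOn_lambertSum_term (c : ℂ) (k : ℕ) (mp : ℕ × ℕ) :
    IntegrableOn (fun x : ℝ => ((x : ℂ) + mp.2) ^ k * Complex.exp (c * (mp.1 + 1) * (x + mp.2)))
      (Set.Ioo 0 1) :=
  (Continuous.integrableOn_Icc (by fun_prop)).mono_set Set.Ioo_subset_Icc_self

theorem summable_integral_norm_lambertSum_term {c : ℂ} (hc : c.re < 0) {k : ℕ} (hk : 1 ≤ k) :
    Summable fun mp : ℕ × ℕ => ∫ x in Set.Ioo (0 : ℝ) 1,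
      ‖((x : ℂ) + mp.2) ^ k * Complex.exp (c * (mp.1 + 1) * (x + mp.2))‖ := by
  have h (m : ℕ) := hasSum_setIntegral_Ioo_comp_add_natCast
    (integrableOn_pow_mul_cexp_mul (re_mul_natCast_add_one_neg hc m) k).norm
  simp only [Complex.ofReal_add, Complex.ofReal_natCast] at h
  rw [summable_prod_of_nonneg fun mp => integral_nonneg fun x => norm_nonneg _]
  refine ⟨fun m => (h m).summable, ?_⟩
  simp only [(h _).tsum_eq, integral_norm_pow_mul_cexp_mul (re_mul_natCast_add_one_neg hc _)]
  have hs := ((summable_nat_add_iff 1).2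
    (Real.summable_one_div_nat_pow.2 (by lia : 1 < k + 1))).mul_left
      ((k ! : ℝ) / (-c.re) ^ (k + 1))
  refine hs.congr fun m => ?_
  have : (c * ((m : ℂ) + 1)).re = c.re * (m + 1) := by simp [Complex.mul_re]
  rw [this, ← neg_mul, mul_pow]
  push_cast
  field_simp

theorem integrableOn_lambertSum {c : ℂ} (hc : c.re < 0) {k : ℕ} (hk : 1 ≤ k) :
    IntegrableOn (lambertSum c k) (Set.Ioo 0 1) :=
  integrable_tsum_of_summable_integral_norm (integrableOn_lambertSum_term c k)
    (summable_integral_norm_lambertSum_term hc hk)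

theorem integral_lambertSum {c : ℂ} (hc : c.re < 0) {k : ℕ} (hk : 1 ≤ k) :
    ∫ x in Set.Ioo (0 : ℝ) 1, lambertSum c k x =
      (k ! : ℂ) / (-c) ^ (k + 1) * ∑' m : ℕ, 1 / ((m : ℂ) + 1) ^ (k + 1) := by
  have hs := hasSum_integral_of_summable_integral_norm (integrableOn_lambertSum_term c k)
    (summable_integral_norm_lambertSum_term hc hk)
  have h (m : ℕ) := hasSum_setIntegral_Ioo_comp_add_natCast
    (integrableOn_pow_mul_cexp_mul (re_mul_natCast_add_one_neg hc m) k)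
  simp only [Complex.ofReal_add, Complex.ofReal_natCast] at h
  simp only [lambertSum]
  rw [← hs.tsum_eq, hs.summable.tsum_prod, ← tsum_mul_left]
  refine tsum_congr fun m => ?_
  rw [(h m).tsum_eq, integral_pow_mul_cexp_mul (re_mul_natCast_add_one_neg hc m), ← neg_mul,
    mul_pow, div_mul_div_comm, mul_one]

theorem integrableOn_Ioo_comp_one_sub {f : ℝ → ℂ} (hf : IntegrableOn f (Set.Ioo 0 1)) :
    IntegrableOn (fun x => f (1 - x)) (Set.Ioo 0 1) := by
  rw [← intervalIntegrable_iff_integrableOn_Ioo_of_le zero_le_one] at hf ⊢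
  simpa using (hf.comp_sub_left 1).symm

theorem integral_Ioo_comp_one_sub (f : ℝ → ℂ) :
    ∫ x in Set.Ioo (0 : ℝ) 1, f (1 - x) = ∫ x in Set.Ioo (0 : ℝ) 1, f x := by
  rw [← integral_Ioc_eq_integral_Ioo, ← integral_Ioc_eq_integral_Ioo,
    ← intervalIntegral.integral_of_le zero_le_one, ← intervalIntegral.integral_of_le zero_le_one,
    intervalIntegral.integral_comp_sub_left, sub_self, sub_zero]

theorem summable_add_natCast_pow_mul_geometric (y : ℂ) (k : ℕ) {r : ℝ} (hr0 : 0 ≤ r)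
    (hr : r < 1) : Summable fun p : ℕ => ‖y + p‖ ^ k * r ^ p := by
  have h : Summable fun p : ℕ => (‖y‖ + p) ^ k * r ^ p := by
    simp only [add_pow, Finset.sum_mul]
    refine summable_sum fun j _ => ?_
    have hj := (summable_pow_mul_geometric_of_norm_lt_one (R := ℝ) (k - j) (r := r)
      (by rwa [Real.norm_of_nonneg hr0])).mul_left (‖y‖ ^ j * k.choose j)
    exact hj.congr fun p => by ring
  refine h.of_nonneg_of_le (fun p => by positivity) fun p => ?_
  gcongr
  simpa using norm_add_le y (p : ℂ)

theorem summable_add_natCast_pow_mul_cexp {c : ℂ} (hc : c.re < 0) {x : ℝ} (hx : 0 < x) (y : ℂ)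
    (k : ℕ) : Summable fun mp : ℕ × ℕ =>
      (y + mp.2) ^ k * Complex.exp (c * (mp.1 + 1) * (x + mp.2)) := by
  have hm := summable_geometric_of_lt_one (Real.exp_pos (c.re * x)).le
    (Real.exp_lt_one_iff.2 (mul_neg_of_neg_of_pos hc hx))
  have hp := summable_add_natCast_pow_mul_geometric y k (Real.exp_pos c.re).le
    (Real.exp_lt_one_iff.2 hc)
  refine Summable.of_norm_bounded (hm.mul_of_nonneg hp (fun _ => by positivity)
    (fun _ => by positivity)) fun mp => ?_
  have hre : (c * (mp.1 + 1) * (x + mp.2)).re = c.re * ((mp.1 + 1) * (x + mp.2)) := by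
    simp [Complex.mul_re, Complex.mul_im]
    ring
  rw [norm_mul, norm_pow, Complex.norm_exp, hre, mul_left_comm (_ ^ mp.1),
    ← Real.exp_nat_mul, ← Real.exp_nat_mul, ← Real.exp_add]
  refine mul_le_mul_of_nonneg_left (Real.exp_le_exp.2 ?_) (by positivity)
  have h : 0 ≤ x + mp.1 * mp.2 := by positivity
  nlinarith [mul_nonneg h (neg_nonneg.2 hc.le)]

theorem tsum_prod_eq_tsum_zero_add {g : ℕ × ℕ → ℂ} (hg : Summable g) :
    ∑' mp, g mp = ∑' m, g (m, 0) + ∑' mp : ℕ × ℕ, g (mp.1, mp.2 + 1) := by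
  have h0 : Summable fun m => g (m, 0) :=
    hg.comp_injective (i := fun m => (m, 0)) fun a b h => (Prod.ext_iff.1 h).1
  have h1 : Summable fun mp : ℕ × ℕ => g (mp.1, mp.2 + 1) :=
    hg.comp_injective (i := fun mp : ℕ × ℕ => (mp.1, mp.2 + 1)) fun a b h => by
      simpa [Prod.ext_iff] using h
  rw [hg.tsum_prod, h1.tsum_prod, ← h0.tsum_add h1.prod]
  exact tsum_congr fun m => (hg.prod_factor m).tsum_eq_zero_add

/-- On the segment from `0` to `τ`, all `f_{i+1}` are given by the same pair of series. -/
theorem fKr_succ_mul_ofReal (i : ℕ) {τ : ℂ} (hτ : 0 < τ.im) {t : ℝ} (ht0 : 0 < t) (ht1 : t < 1) :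
    fKr (i + 1) (τ * t) τ = 2 * π * Complex.I / (i ! : ℂ) *
      ((bernoulli (i + 1) : ℂ) / (i + 1) -
        ∑' mp : ℕ × ℕ, (mp.2 : ℂ) ^ i *
          Complex.exp (2 * π * Complex.I * τ * (mp.1 + 1) * (t + mp.2)) +
        (-1) ^ i * ∑' mp : ℕ × ℕ, (1 + mp.2 : ℂ) ^ i *
          Complex.exp (2 * π * Complex.I * τ * (mp.1 + 1) * ((1 - t : ℝ) + mp.2))) := by
  have hc : (2 * π * Complex.I * τ).re < 0 := by
    simp [Complex.mul_re]
    positivity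
  have hs1 := summable_add_natCast_pow_mul_cexp hc ht0 0 i
  simp only [zero_add] at hs1
  have hs2 := summable_add_natCast_pow_mul_cexp hc (sub_pos.2 ht1) 1 i
  have hs1' : Summable fun mp : ℕ × ℕ => ((mp.2 + 1 : ℕ) : ℂ) ^ i *
      Complex.exp (2 * π * Complex.I * τ * (mp.1 + 1) * (t + (mp.2 + 1 : ℕ))) :=
    hs1.comp_injective (i := fun mp : ℕ × ℕ => (mp.1, mp.2 + 1)) fun a b h => by
      simpa [Prod.ext_iff] using h
  have he1 (m p : ℕ) : Complex.exp (2 * π * Complex.I * (m + 1) * (τ * t)) *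
      Complex.exp (2 * π * Complex.I * τ) ^ ((m + 1) * (p + 1)) =
      Complex.exp (2 * π * Complex.I * τ * (m + 1) * (t + (p + 1 : ℕ))) := by
    rw [← Complex.exp_nat_mul, ← Complex.exp_add]
    congr 1
    push_cast
    ring
  have he2 (m p : ℕ) : Complex.exp (-(2 * π * Complex.I * (m + 1) * (τ * t))) *
      Complex.exp (2 * π * Complex.I * τ) ^ ((m + 1) * (p + 1)) =
      Complex.exp (2 * π * Complex.I * τ * (m + 1) * ((1 - t : ℝ) + p)) := by
    rw [← Complex.exp_nat_mul, ← Complex.exp_add]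
    congr 1
    push_cast
    ring
  rw [tsum_prod_eq_tsum_zero_add hs1]
  cases i with
  | zero =>
    have hcot := pi_mul_cot_pi_q_exp ⟨τ * t, by simpa using mul_pos hτ ht0⟩
    simp only at hcot
    have hr : ‖Complex.exp (2 * π * Complex.I * (τ * t))‖ < 1 :=
      UpperHalfPlane.norm_exp_two_pi_I_lt_one ⟨τ * t, by simpa using mul_pos hτ ht0⟩
    have hgeo : ∑' n : ℕ, Complex.exp (2 * π * Complex.I * (τ * t)) ^ n =
        1 + ∑' m : ℕ, Complex.exp (2 * π * Complex.I * τ * (m + 1) * (t + (0 : ℕ))) := by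
      rw [(summable_geometric_of_norm_lt_one hr).tsum_eq_zero_add, pow_zero]
      congr 1
      refine tsum_congr fun m => ?_
      rw [← Complex.exp_nat_mul]
      congr 1
      push_cast
      ring
    simp only [pow_zero, one_mul] at hs1' hs2 ⊢
    simp only [fKr, hcot, hgeo, sub_mul, he1, he2]
    rw [hs1'.tsum_sub hs2]
    simp
    ring
  | succ i =>
    simp only [fKr]
    have : ∀ mp : ℕ × ℕ, (Complex.exp (2 * π * Complex.I * (mp.1 + 1) * (τ * t)) +
        (-1) ^ (i + 2) * Complex.exp (-(2 * π * Complex.I * (mp.1 + 1) * (τ * t)))) *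
        ((mp.2 : ℂ) + 1) ^ (i + 1) *
          Complex.exp (2 * π * Complex.I * τ) ^ ((mp.1 + 1) * (mp.2 + 1)) =
        ((mp.2 + 1 : ℕ) : ℂ) ^ (i + 1) *
          Complex.exp (2 * π * Complex.I * τ * (mp.1 + 1) * (t + (mp.2 + 1 : ℕ))) +
        (-1) ^ (i + 2) * ((1 + mp.2 : ℂ) ^ (i + 1) *
          Complex.exp (2 * π * Complex.I * τ * (mp.1 + 1) * ((1 - t : ℝ) + mp.2))) := by
      intro mp
      rw [← he1, ← he2]
      push_cast
      ring
    rw [tsum_congr this, hs1'.tsum_add (hs2.mul_left _), tsum_mul_left]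
    simp only [Nat.cast_zero, ne_eq, Nat.add_eq_zero_iff, one_ne_zero, and_false, not_false_eq_true,
      zero_pow, zero_mul, tsum_zero, zero_add]
    generalize ∑' mp : ℕ × ℕ, ((mp.2 + 1 : ℕ) : ℂ) ^ (i + 1) * Complex.exp
      (2 * π * Complex.I * τ * (mp.1 + 1) * (t + (mp.2 + 1 : ℕ))) = X
    push_cast
    ring

theorem lambertSum_eq_sum {c : ℂ} (hc : c.re < 0) {x : ℝ} (hx : 0 < x) (y z : ℂ) (k : ℕ) :
    ∑' mp : ℕ × ℕ, (y + (z + mp.2)) ^ k * Complex.exp (c * (mp.1 + 1) * (x + mp.2)) =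
      (k ! : ℂ) * ∑ i ∈ range (k + 1), y ^ (k - i) / ((k - i)! : ℂ) * (1 / (i ! : ℂ) *
        ∑' mp : ℕ × ℕ, (z + mp.2) ^ i * Complex.exp (c * (mp.1 + 1) * (x + mp.2))) := by
  simp only [← tsum_mul_left]
  rw [← Summable.tsum_finsetSum fun i _ =>
    ((summable_add_natCast_pow_mul_cexp hc hx z i).mul_left _).mul_left _, ← tsum_mul_left]
  refine tsum_congr fun mp => ?_
  rw [add_comm y, add_pow, Finset.sum_mul, Finset.mul_sum]
  refine Finset.sum_congr rfl fun i hi => ?_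
  have hik : i ≤ k := Nat.lt_succ_iff.1 (Finset.mem_range.1 hi)
  rw [Nat.cast_choose ℂ hik]
  field_simp

theorem bernoulliFun_div_factorial (n : ℕ) (t : ℝ) :
    ((bernoulliFun n t : ℝ) : ℂ) / (n ! : ℂ) =
      ∑ i ∈ range (n + 1), (t : ℂ) ^ (n - i) / ((n - i)! : ℂ) * (bernoulli i / (i ! : ℂ)) := by
  simp only [bernoulliFun, Polynomial.bernoulli, Polynomial.map_sum, Polynomial.eval_finsetSum,
    Polynomial.map_monomial, Polynomial.eval_monomial, Complex.ofReal_sum, Finset.sum_div]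
  refine Finset.sum_congr rfl fun i hi => ?_
  have hin : i ≤ n := Nat.lt_succ_iff.1 (Finset.mem_range.1 hi)
  have hn : (n ! : ℂ) ≠ 0 := Nat.cast_ne_zero.2 n.factorial_ne_zero
  simp [Nat.cast_choose ℂ hin]
  field_simp

/-- On the segment from `0` to `τ`, `ω_{N+1}` is a Bernoulli polynomial plus two Lambert sums. -/
theorem omKr_succ_mul_ofReal (N : ℕ) {τ : ℂ} (hτ : 0 < τ.im) {t : ℝ} (ht0 : 0 < t) (ht1 : t < 1) :
    omKr (N + 1) (τ * t) τ = 2 * π * Complex.I *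
      ((bernoulliFun (N + 1) t : ℂ) / ((N + 1)! : ℂ) -
        1 / (N ! : ℂ) * (lambertSum (2 * π * Complex.I * τ) N t +
          (-1) ^ (N + 1) * lambertSum (2 * π * Complex.I * τ) N (1 - t))) := by
  have hc : (2 * π * Complex.I * τ).re < 0 := by
    simp [Complex.mul_re]
    positivity
  have him : (τ * t).im / τ.im = t := by
    simp [Complex.mul_im]
    field_simp
  have h1 := lambertSum_eq_sum hc ht0 t 0 N
  have h2 := lambertSum_eq_sum hc (sub_pos.2 ht1) (-t) 1 N
  set S₁ : ℕ → ℂ := fun i => ∑' mp : ℕ × ℕ, (mp.2 : ℂ) ^ i *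
    Complex.exp (2 * π * Complex.I * τ * (mp.1 + 1) * (t + mp.2))
  set S₂ : ℕ → ℂ := fun i => ∑' mp : ℕ × ℕ, (1 + mp.2 : ℂ) ^ i *
    Complex.exp (2 * π * Complex.I * τ * (mp.1 + 1) * ((1 - t : ℝ) + mp.2))
  have hN : (N ! : ℂ) ≠ 0 := Nat.cast_ne_zero.2 N.factorial_ne_zero
  have hlambert : 1 / (N ! : ℂ) * lambertSum (2 * π * Complex.I * τ) N t =
      ∑ i ∈ range (N + 1), (t : ℂ) ^ (N - i) / ((N - i)! : ℂ) * (1 / (i ! : ℂ) * S₁ i) := by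
    simp only [zero_add] at h1
    rw [lambertSum, h1, ← mul_assoc, one_div_mul_cancel hN, one_mul]
  have hlambert_sub : 1 / (N ! : ℂ) * lambertSum (2 * π * Complex.I * τ) N (1 - t) =
      ∑ i ∈ range (N + 1), (-t : ℂ) ^ (N - i) / ((N - i)! : ℂ) * (1 / (i ! : ℂ) * S₂ i) := by
    have : lambertSum (2 * π * Complex.I * τ) N (1 - t) = ∑' mp : ℕ × ℕ,
        (-t + (1 + mp.2) : ℂ) ^ N *
          Complex.exp (2 * π * Complex.I * τ * (mp.1 + 1) * ((1 - t : ℝ) + mp.2)) := by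
      refine tsum_congr fun mp => ?_
      congr 2
      push_cast
      ring
    rw [this, h2, ← mul_assoc, one_div_mul_cancel hN, one_mul]
  have hreflect : (-1) ^ N * (1 / (N ! : ℂ) * lambertSum (2 * π * Complex.I * τ) N (1 - t)) =
      ∑ i ∈ range (N + 1),
        (t : ℂ) ^ (N - i) / ((N - i)! : ℂ) * ((-1) ^ i * (1 / (i ! : ℂ) * S₂ i)) := by
    rw [hlambert_sub, Finset.mul_sum]
    refine Finset.sum_congr rfl fun i hi => ?_
    obtain ⟨d, rfl⟩ := Nat.exists_eq_add_of_le (Nat.lt_succ_iff.1 (Finset.mem_range.1 hi))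
    rw [Nat.add_sub_cancel_left, neg_pow, pow_add]
    have : ((-1 : ℂ) ^ d) * (-1) ^ d = 1 := by rw [← mul_pow]; simp
    linear_combination (-1) ^ i * (t : ℂ) ^ d / (d ! : ℂ) * (1 / (i ! : ℂ) * S₂ i) * this
  have hω : omKr (N + 1) (τ * t) τ = 2 * π * Complex.I * (t ^ (N + 1) / ((N + 1)! : ℂ)) +
      ∑ i ∈ range (N + 1), (t : ℂ) ^ (N - i) / ((N - i)! : ℂ) * fKr (i + 1) (τ * t) τ := by
    rw [omKr, him, ← Finset.sum_flip, Finset.sum_range_succ', add_comm]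
    congr 1
    · simp [fKr]
      ring
    · refine Finset.sum_congr rfl fun i hi => ?_
      have hi' := Finset.mem_range.1 hi
      rw [Nat.sub_sub_self (by lia : i + 1 ≤ N + 1), Nat.add_sub_add_right]
      push_cast
      rfl
  have hfsum : ∑ i ∈ range (N + 1), (t : ℂ) ^ (N - i) / ((N - i)! : ℂ) * fKr (i + 1) (τ * t) τ =
      2 * π * Complex.I * (∑ i ∈ range (N + 1),
          (t : ℂ) ^ (N - i) / ((N - i)! : ℂ) * (bernoulli (i + 1) / ((i + 1)! : ℂ)) -
        ∑ i ∈ range (N + 1), (t : ℂ) ^ (N - i) / ((N - i)! : ℂ) * (1 / (i ! : ℂ) * S₁ i) +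
        ∑ i ∈ range (N + 1),
          (t : ℂ) ^ (N - i) / ((N - i)! : ℂ) * ((-1) ^ i * (1 / (i ! : ℂ) * S₂ i))) := by
    rw [← Finset.sum_sub_distrib, ← Finset.sum_add_distrib, Finset.mul_sum]
    refine Finset.sum_congr rfl fun i _ => ?_
    have hi1 : (i : ℂ) + 1 ≠ 0 := Nat.cast_add_one_ne_zero i
    have hi2 : (i ! : ℂ) ≠ 0 := Nat.cast_ne_zero.2 i.factorial_ne_zero
    have hf : fKr (i + 1) (τ * t) τ = 2 * π * Complex.I / (i ! : ℂ) *
        ((bernoulli (i + 1) : ℂ) / (i + 1) - S₁ i + (-1) ^ i * S₂ i) :=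
      fKr_succ_mul_ofReal i hτ ht0 ht1
    rw [hf, Nat.factorial_succ]
    push_cast
    field_simp
  rw [hω, hfsum, ← hlambert, ← hreflect, bernoulliFun_div_factorial,
    Finset.sum_range_succ' _ (N + 1)]
  simp only [Nat.add_sub_add_right, Nat.sub_zero, bernoulli_zero, Nat.factorial_zero,
    Nat.cast_one, Rat.cast_one, div_one, mul_one]
  ring

theorem tsum_one_div_natCast_add_one_pow {k : ℕ} (hk : k ≠ 0) :
    ∑' m : ℕ, 1 / ((m : ℂ) + 1) ^ (2 * k) =
      -((2 * π * Complex.I) ^ (2 * k) * bernoulli (2 * k) / (2 * ((2 * k)! : ℂ))) := by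
  have h := hasSum_zeta_nat hk
  have h' : ∑' m : ℕ, 1 / ((m : ℝ) + 1) ^ (2 * k) =
      (-1) ^ (k + 1) * 2 ^ (2 * k - 1) * π ^ (2 * k) * bernoulli (2 * k) / (2 * k)! := by
    rw [← h.tsum_eq, h.summable.tsum_eq_zero_add]
    simp [hk]
  have h2 : (2 : ℂ) ^ (2 * k) = 2 * 2 ^ (2 * k - 1) := by
    rw [← pow_succ', Nat.sub_add_cancel (by lia)]
  have hc := congrArg (fun x : ℝ => (x : ℂ)) h'
  simp only [Complex.ofReal_tsum] at hc
  push_cast at hc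
  rw [hc, mul_pow, mul_pow, h2, pow_mul Complex.I, Complex.I_sq]
  field_simp
  ring

/-- For `n ≥ 2` and `τ ∈ ℍ`, the length-one B-elliptic multiple zeta value
satisfies `B(n;τ) = τⁿ ∫₀¹ ω_n(τt,τ) dt = 2πi·Bₙ/n!`; in particular it is independent of `τ`
and vanishes when `n` is odd. -/
theorem Bell_length_one (n : ℕ) (hn : 2 ≤ n) (τ : ℂ) (hτ : 0 < τ.im) :
    (τ ^ n * ∫ t in Set.Ioo (0 : ℝ) 1, omKr n (τ * ((t : ℝ) : ℂ)) τ) =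
        2 * ↑π * Complex.I * (bernoulli n : ℂ) / (n ! : ℂ) ∧
      (Odd n → (τ ^ n * ∫ t in Set.Ioo (0 : ℝ) 1, omKr n (τ * ((t : ℝ) : ℂ)) τ) = 0) := by
  obtain ⟨N, rfl⟩ : ∃ N, n = N + 1 := ⟨n - 1, by lia⟩
  have hN : 1 ≤ N := by lia
  have hodd : Odd (N + 1) → bernoulli (N + 1) = 0 := fun h => bernoulli_eq_zero_of_odd h hn
  suffices h : (τ ^ (N + 1) * ∫ t in Set.Ioo (0 : ℝ) 1, omKr (N + 1) (τ * ((t : ℝ) : ℂ)) τ) =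
      2 * ↑π * Complex.I * (bernoulli (N + 1) : ℂ) / ((N + 1)! : ℂ) from
    ⟨h, fun ho => by rw [h, hodd ho]; simp⟩
  have hτ0 : τ ≠ 0 := by rintro rfl; simp at hτ
  have hc : (2 * π * Complex.I * τ).re < 0 := by
    simp [Complex.mul_re]
    positivity
  have hB : IntegrableOn (fun t : ℝ => (bernoulliFun (N + 1) t : ℂ) / ((N + 1)! : ℂ))
      (Set.Ioo 0 1) :=
    (Continuous.integrableOn_Icc (by
      have := continuous_bernoulliFun (N + 1)
      fun_prop)).mono_set Set.Ioo_subset_Icc_self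
  have hB0 : ∫ t in Set.Ioo (0 : ℝ) 1, (bernoulliFun (N + 1) t : ℂ) / ((N + 1)! : ℂ) = 0 := by
    rw [integral_div, integral_complex_ofReal, ← integral_Ioc_eq_integral_Ioo,
      ← intervalIntegral.integral_of_le zero_le_one, integral_bernoulliFun_eq_zero N.succ_ne_zero]
    simp
  have hL := integrableOn_lambertSum hc hN
  have hL' := (integrableOn_Ioo_comp_one_sub hL).const_mul ((-1) ^ (N + 1))
  have hS : IntegrableOn (fun t : ℝ => 1 / (N ! : ℂ) * (lambertSum (2 * π * Complex.I * τ) N t +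
      (-1) ^ (N + 1) * lambertSum (2 * π * Complex.I * τ) N (1 - t))) (Set.Ioo 0 1) :=
    (hL.add hL').const_mul _
  rw [setIntegral_congr_fun measurableSet_Ioo fun t ht => omKr_succ_mul_ofReal N hτ ht.1 ht.2,
    integral_const_mul, integral_sub hB hS, hB0, integral_const_mul,
    integral_add hL hL', integral_const_mul, integral_Ioo_comp_one_sub,
    integral_lambertSum hc hN]
  rcases Nat.even_or_odd (N + 1) with he | ho
  · obtain ⟨k, hk⟩ := he.two_dvd
    have hk0 : k ≠ 0 := by rintro rfl; lia
    have hN0 : (N ! : ℂ) ≠ 0 := Nat.cast_ne_zero.2 N.factorial_ne_zero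
    have hz := tsum_one_div_natCast_add_one_pow hk0
    rw [← hk] at hz
    rw [hz, he.neg_one_pow, he.neg_pow, mul_pow _ τ]
    field_simp
    ring
  · rw [ho.neg_one_pow, hodd ho]
    simp
end
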